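/- arXiv:1408.0721 — 3 statements merged into one kernel-verified Lean document; each statement's English description precedes it below -/
import Mathlib

section
/- Let $W$ be a finite subgroup of $\mathrm{GL}(\mathbb{C}^n)$, let $\mathcal{R}$ be the set of reflections of $W$ (elements $w \ne 1$ with $\dim \ker(w-1) = n-1$), and let $\mathcal{R}^*$ be the set of reflecting hyperplanes $\{\ker(r - 1) : r \in \mathcal{R}\}$. Then for every $0 \le i \le n$, $\sum_{r \in \mathcal{R}} \mathrm{tr}\left( \textstyle\bigwedge^i r \right) = |\mathcal{R}| \left( \binom{n}{i} - \binom{n-1}{i-1} \right) - |\mathcal{R}^*| \binom{n-1}{i-1}$, where $\binom{n-1}{-1} = 0$. -/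
open ExteriorAlgebra in
/-- The endomorphism of the `i`-th exterior power `⋀[R]^i M` induced by an endomorphism of `M`. -/
noncomputable def extPowMap {R M : Type*} [CommRing R] [AddCommGroup M] [Module R M]
    (i : ℕ) (f : M →ₗ[R] M) : ⋀[R]^i M →ₗ[R] ⋀[R]^i M :=
  LinearMap.restrict (ExteriorAlgebra.map f).toLinearMap (by
    intro x hx
    rw [← ιMulti_span_fixedDegree] at hx ⊢
    induction hx using Submodule.span_induction with
    | mem y hy =>
        obtain ⟨v, rfl⟩ := hy
        exact Submodule.subset_span ⟨f ∘ v, (map_apply_ιMulti f v).symm⟩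
    | zero => simp
    | add y z _ _ hy hz => rw [map_add]; exact add_mem hy hz
    | smul r y _ hy => rw [map_smul]; exact Submodule.smul_mem _ r hy)

theorem aux_trace {n : ℕ} {M : Type*} [AddCommGroup M] [Module ℂ M] (b : Module.Basis (Fin n) ℂ M)
    (f : M →ₗ[ℂ] M) (d : Fin n → ℂ) (hd : ∀ j, f (b j) = d j • b j) (i : ℕ) :
    LinearMap.trace ℂ (⋀[ℂ]^i M) (extPowMap i f) =
      ∑ s ∈ (Finset.univ : Finset (Fin n)).powersetCard i, ∏ j ∈ s, d j := by
  classical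
  have key : ∀ s : Set.powersetCard (Fin n) i,
      extPowMap i f (b.exteriorPower i s) = (∏ j ∈ s.val, d j) • b.exteriorPower i s := by
    intro s
    rw [exteriorPower.basis_apply]
    apply Subtype.ext
    rw [Submodule.coe_smul, exteriorPower.ιMulti_family_apply_coe]
    change ExteriorAlgebra.map f (ExteriorAlgebra.ιMulti_family ℂ i b s) = _
    unfold ExteriorAlgebra.ιMulti_family
    rw [ExteriorAlgebra.map_apply_ιMulti]
    have : (f ∘ b ∘ (Set.powersetCard.ofFinEmbEquiv.symm s) : Fin i → M) =
      fun k => d (Set.powersetCard.ofFinEmbEquiv.symm s k) •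
        (b ∘ (Set.powersetCard.ofFinEmbEquiv.symm s)) k := by
      funext k; simp [hd]
    rw [this, (ExteriorAlgebra.ιMulti ℂ i).map_smul_univ]
    congr 1
    rw [Set.powersetCard.ofFinEmbEquiv_symm_apply]
    rw [← Finset.prod_coe_sort s.val, ← (s.val.orderIsoOfFin s.prop).toEquiv.prod_comp]
    rfl
  rw [LinearMap.trace_eq_matrix_trace ℂ (b.exteriorPower i), Matrix.trace]
  have : ∀ s, (LinearMap.toMatrix (b.exteriorPower i) (b.exteriorPower i) (extPowMap i f)).diag s
      = ∏ j ∈ s.val, d j := by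
    intro s
    rw [Matrix.diag_apply, LinearMap.toMatrix_apply, key]
    simp [-exteriorPower.coe_basis]
  rw [Finset.sum_congr rfl (fun s _ => this s)]
  symm
  refine Finset.sum_subtype _ ?_ _
  intro x
  simp [Finset.mem_powersetCard]

theorem aux_sum (m i : ℕ) (z : ℂ) :
    ∑ s ∈ (Finset.univ : Finset (Fin (m+1))).powersetCard i,
      ∏ j ∈ s, (Fin.cons z (fun _ => 1) : Fin (m+1) → ℂ) j =
    (m.choose i : ℂ) + z * (if i = 0 then 0 else (m.choose (i-1) : ℂ)) := by
  classical
  rcases i with _ | i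
  · simp
  · rw [Fin.univ_succ, Finset.cons_eq_insert, Finset.powersetCard_succ_insert (by simp),
      Finset.sum_union, Finset.sum_image]
    · have h1 : ∀ s : Finset (Fin (m+1)), 0 ∉ s →
          ∏ j ∈ s, (Fin.cons z (fun _ => 1) : Fin (m+1) → ℂ) j = 1 := by
        intro s hs
        apply Finset.prod_eq_one
        intro j hj
        rcases Fin.eq_zero_or_eq_succ j with rfl | ⟨k, rfl⟩
        · exact absurd hj hs
        · simp
      have h0 : ∀ k, ∀ s ∈ Finset.powersetCard k
          (Finset.map ⟨Fin.succ, Fin.succ_injective _⟩ (Finset.univ : Finset (Fin m))), 0 ∉ s := by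
        intro k s hs h
        have := (Finset.mem_powersetCard.1 hs).1 h
        simp at this
      have e1 := Finset.sum_congr rfl (fun s hs => h1 s (h0 (i+1) s hs))
      have e2 : ∀ s ∈ Finset.powersetCard i
          (Finset.map ⟨Fin.succ, Fin.succ_injective _⟩ (Finset.univ : Finset (Fin m))),
          ∏ j ∈ insert 0 s, (Fin.cons z (fun _ => 1) : Fin (m+1) → ℂ) j = z := fun s hs => by
        rw [Finset.prod_insert (h0 _ s hs), h1 s (h0 _ s hs)]; simp
      have e3 := Finset.sum_congr rfl e2
      refine (congrArg₂ (· + ·) e1 e3).trans ?_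
      simp [mul_comm]
    · intro s hs t ht hst
      have hs' : 0 ∉ s := fun h => by
        have := (Finset.mem_powersetCard.1 hs).1 h
        simp at this
      have ht' : 0 ∉ t := fun h => by
        have := (Finset.mem_powersetCard.1 ht).1 h
        simp at this
      have := congrArg (fun u => Finset.erase u 0) hst
      simpa [hs', ht'] using this
    · rw [Finset.disjoint_left]
      intro s hs hs2
      obtain ⟨t, -, rfl⟩ := Finset.mem_image.1 hs2
      have := (Finset.mem_powersetCard.1 hs).1 (Finset.mem_insert_self 0 t)
      simp at this

theorem aux_basis (m : ℕ) (g : Module.End ℂ (Fin (m+1) → ℂ)) (k : ℕ) (hk : k ≠ 0)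
    (hgk : g ^ k = 1) (h1 : g ≠ 1)
    (hker : Module.finrank ℂ (LinearMap.ker (g - 1)) = m) :
    ∃ (z : ℂ) (b : Module.Basis (Fin (m+1)) ℂ (Fin (m+1) → ℂ)), z ≠ 1 ∧
      ∀ j, g (b j) = (Fin.cons z (fun _ => 1) : Fin (m+1) → ℂ) j • b j := by
  have hrange : Module.finrank ℂ (LinearMap.range (g - 1)) = 1 := by
    have := LinearMap.finrank_range_add_finrank_ker (g - 1)
    rw [hker] at this
    simp at this
    omega
  obtain ⟨⟨v, hv⟩, hv0, hspan⟩ := finrank_eq_one_iff'.1 hrange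
  have hv0' : v ≠ 0 := fun h => hv0 (Subtype.ext h)
  have hsp : ∀ x, ∃ c : ℂ, c • v = (g - 1) x := fun x => by
    obtain ⟨c, hc⟩ := hspan ⟨(g-1) x, LinearMap.mem_range_self _ x⟩
    exact ⟨c, congrArg Subtype.val hc⟩
  obtain ⟨c, hc⟩ := hsp v
  have hc0 : c ≠ 0 := by
    rintro rfl
    rw [zero_smul] at hc
    have hsq : (g - 1) * (g - 1) = 0 := by
      ext1 x
      apply LinearMap.ext
      intro y
      simp only [LinearMap.comp_apply, Module.End.mul_apply]
      obtain ⟨a, ha⟩ := hsp (LinearMap.single ℂ _ x y)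
      rw [← ha, map_smul, ← hc]; simp
    have hpow : ∀ k : ℕ, g ^ k = 1 + k • (g - 1) := by
      intro k
      induction k with
      | zero => simp
      | succ k ih =>
        rw [pow_succ, ih]
        have : (1 + k • (g - 1)) * g = (1 + k • (g-1)) * (1 + (g - 1)) := by congr 1; abel
        rw [this, mul_add, add_mul, add_mul, smul_mul_assoc, smul_mul_assoc, hsq, succ_nsmul]
        simp
        abel
    have h2 := hpow k
    rw [hgk] at h2
    have h3 : k • (g - 1) = 0 := by simpa using h2
    rcases smul_eq_zero.1 h3 with h | h
    · exact hk h
    · exact h1 (sub_eq_zero.1 h)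
  have hgv : g v = (1 + c) • v := by
    have : g v = v + (g - 1) v := by simp
    rw [this, ← hc, add_smul, one_smul]
  let bN : Module.Basis (Fin m) ℂ (LinearMap.ker (g - 1)) :=
    Module.finBasisOfFinrankEq _ _ hker
  let b := Module.Basis.mkFinCons v bN
    (by
      intro a x hx hax
      have := congrArg (fun y => (g - 1) y) hax
      beta_reduce at this
      rw [map_add, map_smul, ← hc, LinearMap.mem_ker.1 hx, map_zero, add_zero, smul_smul] at this
      rcases smul_eq_zero.1 this with h | h
      · exact (mul_eq_zero.1 h).resolve_right hc0
      · exact absurd h hv0')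
    (by
      intro x
      obtain ⟨a, ha⟩ := hsp x
      refine ⟨-(a / c), ?_⟩
      rw [LinearMap.mem_ker, map_add, map_smul, ← hc, ← ha, smul_smul, ← add_smul]
      have : a + -(a / c) * c = 0 := by field_simp; ring
      rw [this, zero_smul])
  refine ⟨1 + c, b, by simpa using hc0, ?_⟩
  intro j
  rw [Module.Basis.coe_mkFinCons]
  rcases Fin.eq_zero_or_eq_succ j with rfl | ⟨j, rfl⟩
  · simpa using hgv
  · simp only [Fin.cons_succ, Function.comp_apply, one_smul]
    have := LinearMap.mem_ker.1 (bN j).2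
    rw [LinearMap.sub_apply, Module.End.one_apply] at this
    exact sub_eq_zero.1 this

theorem aux_refl (m : ℕ) (g : Module.End ℂ (Fin (m+1) → ℂ)) (k : ℕ) (hk : k ≠ 0)
    (hgk : g ^ k = 1) (h1 : g ≠ 1)
    (hker : Module.finrank ℂ (LinearMap.ker (g - 1)) = m) :
    LinearMap.det g ≠ 1 ∧ ∀ i, LinearMap.trace ℂ (⋀[ℂ]^i (Fin (m+1) → ℂ)) (extPowMap i g) =
      (m.choose i : ℂ) + LinearMap.det g * (if i = 0 then 0 else (m.choose (i-1) : ℂ)) := by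
  obtain ⟨z, b, hz, hb⟩ := aux_basis m g k hk hgk h1 hker
  have hdet : LinearMap.det g = z := by
    rw [← LinearMap.det_toMatrix b]
    have : LinearMap.toMatrix b b g =
        Matrix.diagonal (Fin.cons z (fun _ => 1) : Fin (m+1) → ℂ) := by
      ext p q
      rw [LinearMap.toMatrix_apply, hb]
      by_cases h : p = q
      · subst h; simp
      · simp [h]
    rw [this, Matrix.det_diagonal, Fin.prod_univ_succ]
    simp
  refine ⟨hdet ▸ hz, fun i => ?_⟩
  rw [aux_trace b g _ hb, aux_sum, hdet]

theorem aux_count {m : ℕ} (W : Subgroup (Module.End ℂ (Fin (m+1) → ℂ))ˣ) [Finite ↥W]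
    (R : Finset (Module.End ℂ (Fin (m+1) → ℂ))ˣ)
    (hR : ∀ g : (Module.End ℂ (Fin (m+1) → ℂ))ˣ, g ∈ R ↔
      g ∈ W ∧ g ≠ 1 ∧
        Module.finrank ℂ (LinearMap.ker ((g : Module.End ℂ (Fin (m+1) → ℂ)) - 1)) = m)
    (hdet : ∀ r ∈ R, LinearMap.det (r : Module.End ℂ (Fin (m+1) → ℂ)) ≠ 1)
    (Rstar : Finset (Submodule ℂ (Fin (m+1) → ℂ)))
    (hRstar : ∀ H : Submodule ℂ (Fin (m+1) → ℂ), H ∈ Rstar ↔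
      ∃ r ∈ R, LinearMap.ker ((r : Module.End ℂ (Fin (m+1) → ℂ)) - 1) = H) :
    ∑ r ∈ R, LinearMap.det (r : Module.End ℂ (Fin (m+1) → ℂ)) = - (Rstar.card : ℂ) := by
  classical
  rw [← Finset.sum_fiberwise_of_maps_to (s := R) (t := Rstar)
    (g := fun r => LinearMap.ker ((r : Module.End ℂ (Fin (m+1) → ℂ)) - 1))
    (fun r hr => (hRstar _).2 ⟨r, hr, rfl⟩)]
  rw [Finset.sum_congr (g := fun _ => (-1 : ℂ)) rfl]
  · simp
  intro H hH
  obtain ⟨r, hr, hrH⟩ := (hRstar H).1 hH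
  have memk : ∀ (g : (Module.End ℂ (Fin (m+1) → ℂ))ˣ) x,
    x ∈ LinearMap.ker ((g : Module.End ℂ (Fin (m+1) → ℂ)) - 1) ↔
      (g : Module.End ℂ (Fin (m+1) → ℂ)) x = x := by
    intro g x
    simp [sub_eq_zero]
  let G : Subgroup (Module.End ℂ (Fin (m+1) → ℂ))ˣ :=
    { carrier := {g | g ∈ W ∧ ∀ x ∈ H, (g : Module.End ℂ (Fin (m+1) → ℂ)) x = x}
      mul_mem' := by
        rintro a b ⟨ha, ha'⟩ ⟨hb, hb'⟩
        refine ⟨W.mul_mem ha hb, fun x hx => ?_⟩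
        rw [Units.val_mul, Module.End.mul_apply, hb' x hx, ha' x hx]
      one_mem' := ⟨W.one_mem, fun x _ => rfl⟩
      inv_mem' := by
        rintro a ⟨ha, ha'⟩
        refine ⟨W.inv_mem ha, fun x hx => ?_⟩
        conv_lhs => rw [← ha' x hx]
        rw [← Module.End.mul_apply, Units.inv_mul, Module.End.one_apply] }
  have hG : ∀ g, g ∈ G ↔ g ∈ W ∧ ∀ x ∈ H, (g : Module.End ℂ (Fin (m+1) → ℂ)) x = x :=
    fun g => Iff.rfl
  have hfin : Finite G := Finite.of_injective (fun g : G => (⟨g.1, ((hG _).1 g.2).1⟩ : W))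
    (fun a b h => Subtype.ext (congrArg (fun u : W => u.1) h))
  have : Fintype G := Fintype.ofFinite _
  let f : G →* ℂ := (LinearMap.det : Module.End ℂ (Fin (m+1) → ℂ) →* ℂ).comp
    ((Units.coeHom _).comp G.subtype)
  have hf : f ≠ 1 := by
    intro h
    have hrG : r ∈ G := (hG r).2 ⟨((hR r).1 hr).1, fun x hx => (memk r x).1 (hrH ▸ hx)⟩
    exact hdet r hr (DFunLike.congr_fun h ⟨r, hrG⟩)
  have hsum := sum_hom_units_eq_zero f hf
  have hfr : Module.finrank ℂ H = m := by rw [← hrH]; exact ((hR r).1 hr).2.2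
  have hset : ∀ g : (Module.End ℂ (Fin (m+1) → ℂ))ˣ, g ∈ insert 1 (R.filter (fun r : (Module.End ℂ (Fin (m+1) → ℂ))ˣ =>
      LinearMap.ker ((r : Module.End ℂ (Fin (m+1) → ℂ)) - 1) = H)) ↔ g ∈ G := by
    intro g
    rw [Finset.mem_insert, Finset.mem_filter]
    constructor
    · rintro (rfl | ⟨h1, h2⟩)
      · exact G.one_mem
      · exact (hG g).2 ⟨((hR g).1 h1).1, fun x hx => (memk g x).1 (h2 ▸ hx)⟩
    · intro hg
      by_cases h1 : g = 1
      · exact Or.inl h1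
      right
      obtain ⟨hgW, hgH⟩ := (hG g).1 hg
      have hle : H ≤ LinearMap.ker ((g : Module.End ℂ (Fin (m+1) → ℂ)) - 1) :=
        fun x hx => (memk g x).2 (hgH x hx)
      have hlt : Module.finrank ℂ (LinearMap.ker ((g : Module.End ℂ (Fin (m+1) → ℂ)) - 1))
          < m + 1 := by
        have hne : LinearMap.ker ((g : Module.End ℂ (Fin (m+1) → ℂ)) - 1) ≠ ⊤ := by
          intro h
          exact h1 (Units.ext (sub_eq_zero.1 (LinearMap.ker_eq_top.1 h)))
        simpa using Submodule.finrank_lt hne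
      have hle' := Submodule.finrank_mono hle
      have hk : Module.finrank ℂ (LinearMap.ker ((g : Module.End ℂ (Fin (m+1) → ℂ)) - 1)) = m := by
        omega
      exact ⟨(hR g).2 ⟨hgW, h1, hk⟩, (Submodule.eq_of_le_of_finrank_eq hle (by omega)).symm⟩
  have h2 := Finset.sum_subtype (F := this) _ hset
    (fun g : (Module.End ℂ (Fin (m+1) → ℂ))ˣ => LinearMap.det (g : Module.End ℂ (Fin (m+1) → ℂ)))
  have h3 : ∑ g : G, LinearMap.det ((g : (Module.End ℂ (Fin (m+1) → ℂ))ˣ) :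
      Module.End ℂ (Fin (m+1) → ℂ)) = 0 := hsum
  have h4 := h2.trans h3
  rw [Finset.sum_insert (by
    intro h
    exact ((hR 1).1 (Finset.mem_filter.1 h).1).2.1 rfl)] at h4
  simp only [Units.val_one, map_one] at h4
  linear_combination h4

/-- For a finite subgroup `W ≤ GL(ℂⁿ)` with set of reflections `R` and set of reflecting
hyperplanes `R*`, for every `0 ≤ i ≤ n`,
`∑_{r ∈ R} tr (⋀^i r) = |R|·(C(n,i) - C(n-1,i-1)) - |R*|·C(n-1,i-1)`, where `C(n-1,-1) = 0`. -/
theorem stmt_5 (n : ℕ) (W : Subgroup (Module.End ℂ (Fin n → ℂ))ˣ) [Finite ↥W]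
    (R : Finset (Module.End ℂ (Fin n → ℂ))ˣ)
    (hR : ∀ g : (Module.End ℂ (Fin n → ℂ))ˣ, g ∈ R ↔
      g ∈ W ∧ g ≠ 1 ∧
        Module.finrank ℂ (LinearMap.ker ((g : Module.End ℂ (Fin n → ℂ)) - 1)) = n - 1)
    (Rstar : Finset (Submodule ℂ (Fin n → ℂ)))
    (hRstar : ∀ H : Submodule ℂ (Fin n → ℂ), H ∈ Rstar ↔
      ∃ r ∈ R, LinearMap.ker ((r : Module.End ℂ (Fin n → ℂ)) - 1) = H)
    (i : ℕ) (hi : i ≤ n) :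
    ∑ r ∈ R,
        LinearMap.trace ℂ (⋀[ℂ]^i (Fin n → ℂ))
          (extPowMap i ((r : (Module.End ℂ (Fin n → ℂ))ˣ) : Module.End ℂ (Fin n → ℂ))) =
      (R.card : ℂ) * ((n.choose i : ℂ) - (if i = 0 then 0 else ((n - 1).choose (i - 1)))) -
        (Rstar.card : ℂ) * (if i = 0 then 0 else ((n - 1).choose (i - 1))) := by
  rcases n with _ | m
  · have hRe : R = ∅ := by
      apply Finset.eq_empty_of_forall_notMem
      intro g hg
      exact ((hR g).1 hg).2.1 (Subsingleton.elim _ _)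
    have hSe : Rstar = ∅ := by
      apply Finset.eq_empty_of_forall_notMem
      intro H hH
      obtain ⟨r, hr, -⟩ := (hRstar H).1 hH
      simp [hRe] at hr
    simp [hRe, hSe]
  · simp only [Nat.add_sub_cancel] at hR ⊢
    have key : ∀ r ∈ R, LinearMap.det (r : Module.End ℂ (Fin (m+1) → ℂ)) ≠ 1 ∧
        ∀ i, LinearMap.trace ℂ (⋀[ℂ]^i (Fin (m+1) → ℂ)) (extPowMap i (r : Module.End ℂ (Fin (m+1) → ℂ))) =
        (m.choose i : ℂ) + LinearMap.det (r : Module.End ℂ (Fin (m+1) → ℂ)) *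
          (if i = 0 then 0 else (m.choose (i-1) : ℂ)) := by
      intro r hr
      obtain ⟨hW, h1, hk⟩ := (hR r).1 hr
      refine aux_refl m _ (Nat.card W) Nat.card_pos.ne' ?_ (fun h => h1 (Units.ext h)) hk
      have := pow_card_eq_one' (x := (⟨r, hW⟩ : W))
      have h := congrArg (fun u : W => ((u : (Module.End ℂ (Fin (m+1) → ℂ))ˣ) :
        Module.End ℂ (Fin (m+1) → ℂ))) this
      exact h
    have hc := aux_count W R hR (fun r hr => (key r hr).1) Rstar hRstar
    rw [Finset.sum_congr rfl (fun r hr => (key r hr).2 i), Finset.sum_add_distrib,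
      ← Finset.sum_mul, hc]
    rcases i with _ | i
    · simp
    · simp [Nat.choose_succ_succ]
      ring
end

section
/- Let $W$ be a finite subgroup of $\mathrm{GL}(\mathbb{C}^n)$ acting irreducibly on $\mathbb{C}^n$ and generated by its set $\mathcal{R}$ of reflections, let $\mathcal{R}^*$ be the set of reflecting hyperplanes of $W$, let $c \in W$, and for $l \ge 0$ let $N_l = |\{(r_1,\ldots,r_l) \in \mathcal{R}^l : r_1 \cdots r_l = c\}|$. If for every $l \ge 0$ one has $|W| \cdot N_l = \sum_{i=0}^{n} (-1)^i \sum_{(r_1,\ldots,r_l) \in \mathcal{R}^l} \mathrm{tr}\left( \textstyle\bigwedge^i (r_1 \cdots r_l) \right)$, then for every $t \in \mathbb{R}$, $\sum_{l=0}^{\infty} \frac{t^l}{l!} N_l = \frac{1}{|W|} \left( e^{t |\mathcal{R}| / n} - e^{-t |\mathcal{R}^*| / n} \right)^n$. -/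
section helpers

lemma extPowMap_ιMulti {R M : Type*} [CommRing R] [AddCommGroup M] [Module R M]
    (i : ℕ) (f : M →ₗ[R] M) (v : Fin i → M) :
    extPowMap i f (exteriorPower.ιMulti R i v) = exteriorPower.ιMulti R i (f ∘ v) := by
  apply Subtype.ext
  simp [extPowMap, LinearMap.restrict_apply, ExteriorAlgebra.map_apply_ιMulti]

lemma extPow_ext {R M N : Type*} [CommRing R] [AddCommGroup M] [Module R M]
    [AddCommGroup N] [Module R N]
    {i : ℕ} {f g : ⋀[R]^i M →ₗ[R] N}
    (h : ∀ v, f (exteriorPower.ιMulti R i v) = g (exteriorPower.ιMulti R i v)) : f = g := by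
  rw [Submodule.linearMap_eq_iff_of_span_eq_top _ _ (exteriorPower.ιMulti_span R i M)]
  rintro ⟨_, ⟨v, rfl⟩⟩
  exact h v

lemma extPowMap_one' {R M : Type*} [CommRing R] [AddCommGroup M] [Module R M] (i : ℕ) :
    extPowMap i (1 : Module.End R M) = (1 : Module.End R (⋀[R]^i M)) := by
  apply extPow_ext
  intro v
  rw [extPowMap_ιMulti]
  rfl

lemma extPowMap_mul' {R M : Type*} [CommRing R] [AddCommGroup M] [Module R M] (i : ℕ)
    (f g : Module.End R M) :
    (extPowMap i (f * g) : Module.End R (⋀[R]^i M)) =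
      (extPowMap i f : Module.End R (⋀[R]^i M)) * extPowMap i g := by
  apply extPow_ext
  intro v
  rw [Module.End.mul_apply, extPowMap_ιMulti, extPowMap_ιMulti, extPowMap_ιMulti]
  rfl

lemma extPowMap_rank_one {R M : Type*} [CommRing R] [AddCommGroup M] [Module R M] (i : ℕ)
    (f : Module.End R M) (u : M) (a : M → R) (hf : ∀ x, f x - x = a x • u) (v : Fin i → M) :
    extPowMap i f (exteriorPower.ιMulti R i v) = exteriorPower.ιMulti R i v +
      ∑ j, exteriorPower.ιMulti R i (Function.update v j (f (v j) - v j)) := by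
  rw [extPowMap_ιMulti]
  have h1 : f ∘ v = v + (fun j => f (v j) - v j) := by
    ext j; simp
  rw [h1]
  have := MultilinearMap.map_add_eq_map_add_linearDeriv_add
    (exteriorPower.ιMulti R i (M := M)).toMultilinearMap v (fun j => f (v j) - v j)
  rw [MultilinearMap.linearDeriv_apply] at this
  simp only [AlternatingMap.coe_multilinearMap] at this
  rw [this, add_eq_left]
  apply Finset.sum_eq_zero
  intro s hs
  simp only [Finset.mem_filter, Finset.mem_univ, true_and] at hs
  obtain ⟨p, hp, q, hq, hpq⟩ := Finset.one_lt_card.mp hs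
  set w : Fin i → M := s.piecewise (fun j => f (v j) - v j) v with hw
  have hwp : w p = a (v p) • u := by simp [hw, hp, hf]
  have hwq : w q = a (v q) • u := by simp [hw, hq, hf]
  have e1 : w = Function.update w p (a (v p) • u) := by rw [← hwp]; simp
  have e2 : Function.update w p u = Function.update (Function.update w p u) q (a (v q) • u) := by
    rw [← hwq, eq_comm, Function.update_eq_self_iff, Function.update_of_ne hpq.symm]
  rw [e1, AlternatingMap.map_update_smul, e2, AlternatingMap.map_update_smul]
  rw [AlternatingMap.map_eq_zero_of_eq _ _ (i := p) (j := q) _ hpq]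
  · simp
  · simp [Function.update_of_ne hpq]

lemma sum_prod_ofFn {A G : Type*} [Semiring A] [Monoid G] (φ : G →* A) (R : Finset G) (l : ℕ) :
    ∑ f : Fin l → ↥R, φ (List.ofFn fun k => (f k : G)).prod = (∑ r ∈ R, φ r) ^ l := by
  induction l with
  | zero => simp
  | succ l ih =>
    rw [← (Fin.consEquiv (fun _ => ↥R)).sum_comp, Fintype.sum_prod_type, pow_succ', ← ih,
      ← Finset.sum_coe_sort R, Finset.sum_mul]
    refine Finset.sum_congr rfl fun r _ => ?_
    rw [Finset.mul_sum]
    refine Finset.sum_congr rfl fun f _ => ?_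
    simp [Fin.consEquiv, List.ofFn_succ]

noncomputable def extPowHom {R M : Type*} [CommRing R] [AddCommGroup M] [Module R M] (i : ℕ) :
    (Module.End R M)ˣ →* Module.End R (⋀[R]^i M) where
  toFun g := extPowMap i (g : Module.End R M)
  map_one' := by
    rw [Units.val_one]
    exact extPowMap_one' i
  map_mul' f g := by
    rw [Units.val_mul]
    exact extPowMap_mul' i _ _

lemma sum_extPow {M : Type*} [AddCommGroup M] [Module ℂ M] [FiniteDimensional ℂ M]
    (R : Finset (Module.End ℂ M)ˣ)
    (hR : ∀ g ∈ R, ∃ (u : M) (a : M → ℂ), ∀ x, (g : Module.End ℂ M) x - x = a x • u)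
    (s : ℂ) (hs : ∀ x, ∑ g ∈ R, ((g : Module.End ℂ M) x - x) = s • x) (i : ℕ) :
    ∑ g ∈ R, extPowHom i g = ((R.card : ℂ) + i * s) • (1 : Module.End ℂ (⋀[ℂ]^i M)) := by
  apply extPow_ext
  intro v
  rw [LinearMap.sum_apply]
  have : ∀ g ∈ R, extPowHom i g (exteriorPower.ιMulti ℂ i v) = exteriorPower.ιMulti ℂ i v +
      ∑ j, exteriorPower.ιMulti ℂ i (Function.update v j ((g : Module.End ℂ M) (v j) - v j)) := by
    intro g hg
    obtain ⟨u, a, h⟩ := hR g hg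
    exact extPowMap_rank_one i _ u a h v
  rw [Finset.sum_congr rfl this, Finset.sum_add_distrib, Finset.sum_comm]
  have h2 : ∀ j, ∑ g ∈ R, exteriorPower.ιMulti ℂ i
      (Function.update v j ((g : Module.End ℂ M) (v j) - v j)) =
      s • exteriorPower.ιMulti ℂ i v := by
    intro j
    rw [← AlternatingMap.map_update_sum, hs, AlternatingMap.map_update_smul,
      Function.update_eq_self]
  simp only [h2]
  simp [add_smul, mul_smul, ← Nat.cast_smul_eq_nsmul ℂ]

lemma rank_one_form (n : ℕ) (hn : 0 < n) (g : Module.End ℂ (Fin n → ℂ))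
    (h : Module.finrank ℂ (LinearMap.ker (g - 1)) = n - 1) :
    ∃ (u : Fin n → ℂ) (a : (Fin n → ℂ) → ℂ), ∀ x, g x - x = a x • u := by
  have h1 := LinearMap.finrank_range_add_finrank_ker (g - 1)
  rw [h, Module.finrank_fin_fun] at h1
  have h2 : Module.finrank ℂ (LinearMap.range (g - 1)) = 1 := by omega
  obtain ⟨u, -, hu⟩ := finrank_eq_one_iff'.1 h2
  choose a ha using fun x => hu ⟨(g - 1) x, LinearMap.mem_range_self _ x⟩
  refine ⟨u, a, fun x => ?_⟩
  have := congrArg Subtype.val (ha x)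
  simpa using this.symm

lemma sum_trace_group {V : Type*} [AddCommGroup V] [Module ℂ V] [FiniteDimensional ℂ V]
    (G : Subgroup (Module.End ℂ V)ˣ) [Fintype ↥G] (H : Submodule ℂ V)
    (hH : ∀ x, x ∈ H ↔ ∀ g ∈ G, (g : Module.End ℂ V) x = x) :
    ∑ g : ↥G, LinearMap.trace ℂ V ((g : (Module.End ℂ V)ˣ) : Module.End ℂ V) =
      Fintype.card ↥G * Module.finrank ℂ H := by
  let ρ : Representation ℂ ↥G V := (Units.coeHom _).comp G.subtype
  have h0 : (Fintype.card ↥G : ℂ) ≠ 0 := by simp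
  let _ : Invertible (Fintype.card ↥G : ℂ) := invertibleOfNonzero h0
  have h1 := ρ.isProj_averageMap.trace
  have h2 : ρ.invariants = H := by
    ext x
    rw [hH, Representation.mem_invariants]
    simp [ρ]
  rw [h2] at h1
  have h3 : ρ.averageMap = (Fintype.card ↥G : ℂ)⁻¹ •
      ∑ g : ↥G, ((g : (Module.End ℂ V)ˣ) : Module.End ℂ V) := by
    simp [Representation.averageMap, GroupAlgebra.average, ρ]
  rw [h3, map_smul, map_sum, smul_eq_mul] at h1
  rw [← h1]
  field_simp

end helpers

/-- Let `W ≤ GL(ℂⁿ)` be a finite subgroup acting irreducibly and generated by its set `R` of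
reflections, with set `R*` of reflecting hyperplanes, let `c ∈ W`, and let `N_l` be the number of
`l`-tuples of reflections with product `c`.  If for every `l`,
`|W|·N_l = ∑_{i=0}^n (-1)ⁱ ∑_{(r₁,…,r_l) ∈ Rˡ} tr (⋀^i (r₁⋯r_l))`  (formula (1'')), then for
every real `t`, `∑_{l≥0} (tˡ/l!) N_l = (1/|W|)(e^{t|R|/n} - e^{-t|R*|/n})ⁿ`. -/
theorem stmt_7 (n : ℕ) (hn : 0 < n) (W : Subgroup (Module.End ℂ (Fin n → ℂ))ˣ) [Finite ↥W]
    (hirr : ∀ U : Submodule ℂ (Fin n → ℂ),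
      (∀ g ∈ W, ∀ x ∈ U, (g : Module.End ℂ (Fin n → ℂ)) x ∈ U) → U = ⊥ ∨ U = ⊤)
    (R : Finset (Module.End ℂ (Fin n → ℂ))ˣ)
    (hR : ∀ g : (Module.End ℂ (Fin n → ℂ))ˣ, g ∈ R ↔
      g ∈ W ∧ g ≠ 1 ∧
        Module.finrank ℂ (LinearMap.ker ((g : Module.End ℂ (Fin n → ℂ)) - 1)) = n - 1)
    (hgen : Subgroup.closure (R : Set (Module.End ℂ (Fin n → ℂ))ˣ) = W)
    (Rstar : Finset (Submodule ℂ (Fin n → ℂ)))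
    (hRstar : ∀ H : Submodule ℂ (Fin n → ℂ), H ∈ Rstar ↔
      ∃ r ∈ R, LinearMap.ker ((r : Module.End ℂ (Fin n → ℂ)) - 1) = H)
    (c : (Module.End ℂ (Fin n → ℂ))ˣ) (hc : c ∈ W)
    (N : ℕ → ℕ)
    (hN : ∀ l : ℕ, N l = Nat.card
      {f : Fin l → ↥R // (List.ofFn fun k => ((f k : (Module.End ℂ (Fin n → ℂ))ˣ))).prod = c})
    (hyp : ∀ l : ℕ, (Nat.card ↥W : ℂ) * N l =
      ∑ i ∈ Finset.range (n + 1), (-1 : ℂ) ^ i *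
        ∑ f : Fin l → ↥R,
          LinearMap.trace ℂ (⋀[ℂ]^i (Fin n → ℂ))
            (extPowMap i
              (((List.ofFn fun k => ((f k : (Module.End ℂ (Fin n → ℂ))ˣ))).prod :
                  (Module.End ℂ (Fin n → ℂ))ˣ) : Module.End ℂ (Fin n → ℂ)))) :
    ∀ t : ℝ,
      ∑' l : ℕ, t ^ l / l.factorial * (N l : ℝ) =
        (1 / (Nat.card ↥W : ℝ)) *
          (Real.exp (t * R.card / n) - Real.exp (-(t * Rstar.card) / n)) ^ n := by
  classical
  have hfr : Module.finrank ℂ (Fin n → ℂ) = n := Module.finrank_fin_fun ℂ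
  have : Nontrivial (Fin n → ℂ) := Module.nontrivial_of_finrank_pos (R := ℂ) (by omega)
  -- conjugation
  have hconj : ∀ w ∈ W, ∀ r ∈ R, w * r * w⁻¹ ∈ R := by
    intro w hw r hr
    obtain ⟨a, b, d⟩ := (hR r).1 hr
    refine (hR _).2 ⟨W.mul_mem (W.mul_mem hw a) (W.inv_mem hw), ?_, ?_⟩
    · intro h
      apply b
      have : w * r = w := by simpa [mul_inv_eq_one] using h
      simpa using this
    · rw [← d]
      let e : (Fin n → ℂ) ≃ₗ[ℂ] (Fin n → ℂ) := LinearMap.GeneralLinearGroup.generalLinearEquiv ℂ (Fin n → ℂ) w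
      have : LinearMap.ker (((w * r * w⁻¹ : (Module.End ℂ (Fin n → ℂ))ˣ) : Module.End ℂ (Fin n → ℂ)) - 1) =
          (LinearMap.ker ((r : Module.End ℂ (Fin n → ℂ)) - 1)).map (e : (Fin n → ℂ) →ₗ[ℂ] (Fin n → ℂ)) := by
        have hes : ∀ x, e.symm x = ((w⁻¹ : (Module.End ℂ (Fin n → ℂ))ˣ) : Module.End ℂ (Fin n → ℂ)) x := fun _ => rfl
        have hinv : ∀ x, (w : Module.End ℂ (Fin n → ℂ)) (((w⁻¹ : (Module.End ℂ (Fin n → ℂ))ˣ) : Module.End ℂ (Fin n → ℂ)) x) = x := by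
          intro x
          rw [← Module.End.mul_apply, Units.mul_inv]; rfl
        have hinv' : ∀ x, ((w⁻¹ : (Module.End ℂ (Fin n → ℂ))ˣ) : Module.End ℂ (Fin n → ℂ)) ((w : Module.End ℂ (Fin n → ℂ)) x) = x := by
          intro x
          rw [← Module.End.mul_apply, Units.inv_mul]; rfl
        ext x
        rw [Submodule.mem_map_equiv, hes]
        simp only [LinearMap.mem_ker, LinearMap.sub_apply, Module.End.one_apply, sub_eq_zero,
          Units.val_mul, Module.End.mul_apply]
        constructor
        · intro h
          have := congrArg ((w⁻¹ : (Module.End ℂ (Fin n → ℂ))ˣ) : Module.End ℂ (Fin n → ℂ)) h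
          rwa [hinv'] at this
        · intro h
          rw [h, hinv]
      rw [this]
      exact LinearEquiv.finrank_map_eq e _
  -- Schur
  set A : Module.End ℂ (Fin n → ℂ) := ∑ r ∈ R, (r : Module.End ℂ (Fin n → ℂ)) with hA
  have hcomm : ∀ w ∈ W, (w : Module.End ℂ (Fin n → ℂ)) * A = A * w := by
    intro w hw
    rw [hA, Finset.mul_sum, Finset.sum_mul]
    refine Finset.sum_bij' (fun r _ => w * r * w⁻¹) (fun r _ => w⁻¹ * r * w)
      (fun r hr => hconj w hw r hr)
      (fun r hr => by simpa using hconj w⁻¹ (W.inv_mem hw) r hr) ?_ ?_ ?_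
    · intro r _; group
    · intro r _; group
    · intro r _
      rw [← Units.val_mul, ← Units.val_mul]
      congr 1
      group
  obtain ⟨m, hm⟩ := Module.End.exists_eigenvalue A
  have hAm : ∀ x, A x = m • x := by
    have h1 := hirr (A.eigenspace m) (by
      intro g hg x hx
      rw [Module.End.mem_eigenspace_iff] at hx ⊢
      rw [← Module.End.mul_apply, ← hcomm g hg, Module.End.mul_apply, hx, map_smul])
    have h2 := h1.resolve_left hm
    intro x
    rw [← Module.End.mem_eigenspace_iff, h2]
    trivial
  -- hyperplane sums
  have hH : ∀ H ∈ Rstar, ∑ r ∈ R.filter (fun r : (Module.End ℂ (Fin n → ℂ))ˣ => LinearMap.ker ((r : Module.End ℂ (Fin n → ℂ)) - 1) = H),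
      LinearMap.trace ℂ (Fin n → ℂ) (r : Module.End ℂ (Fin n → ℂ)) =
      ((R.filter fun r : (Module.End ℂ (Fin n → ℂ))ˣ => LinearMap.ker ((r : Module.End ℂ (Fin n → ℂ)) - 1) = H).card : ℂ)
        * (n - 1) - 1 := by
    intro H hHR
    obtain ⟨r0, hr0, hk0⟩ := (hRstar H).1 hHR
    have hfH : Module.finrank ℂ H = n - 1 := by rw [← hk0]; exact ((hR r0).1 hr0).2.2
    have hfix : ∀ (g : (Module.End ℂ (Fin n → ℂ))ˣ) x, x ∈ LinearMap.ker ((g : Module.End ℂ (Fin n → ℂ)) - 1) ↔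
        (g : Module.End ℂ (Fin n → ℂ)) x = x := by
      intro g x; simp [sub_eq_zero]
    let G : Subgroup (Module.End ℂ (Fin n → ℂ))ˣ :=
      { carrier := {g | g ∈ W ∧ ∀ x ∈ H, (g : Module.End ℂ (Fin n → ℂ)) x = x}
        one_mem' := ⟨W.one_mem, by simp⟩
        mul_mem' := by
          rintro a b ⟨ha, ha'⟩ ⟨hb, hb'⟩
          refine ⟨W.mul_mem ha hb, fun x hx => ?_⟩
          rw [Units.val_mul, Module.End.mul_apply, hb' x hx, ha' x hx]
        inv_mem' := by
          rintro a ⟨ha, ha'⟩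
          refine ⟨W.inv_mem ha, fun x hx => ?_⟩
          conv_lhs => rw [← ha' x hx]
          rw [← Module.End.mul_apply, Units.inv_mul]; rfl }
    have hG : ∀ g, g ∈ G ↔ g ∈ W ∧ ∀ x ∈ H, (g : Module.End ℂ (Fin n → ℂ)) x = x := fun g => Iff.rfl
    set S := R.filter fun r : (Module.End ℂ (Fin n → ℂ))ˣ => LinearMap.ker ((r : Module.End ℂ (Fin n → ℂ)) - 1) = H
      with hS
    have hmem : ∀ g, g ∈ insert 1 S ↔ g ∈ G := by
      intro g
      rw [Finset.mem_insert, hS, Finset.mem_filter, hG]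
      constructor
      · rintro (rfl | ⟨h1, h2⟩)
        · exact G.one_mem
        · refine ⟨((hR g).1 h1).1, fun x hx => ?_⟩
          rw [← h2] at hx
          exact (hfix g x).1 hx
      · rintro ⟨h1, h2⟩
        by_cases hg : g = 1
        · exact Or.inl hg
        right
        have hle : H ≤ LinearMap.ker ((g : Module.End ℂ (Fin n → ℂ)) - 1) := fun x hx =>
          (hfix g x).2 (h2 x hx)
        have hlt : Module.finrank ℂ (LinearMap.ker ((g : Module.End ℂ (Fin n → ℂ)) - 1)) < n := by
          refine lt_of_lt_of_eq (Submodule.finrank_lt ?_) hfr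
          intro htop
          apply hg
          apply Units.ext
          rw [LinearMap.ker_eq_top, sub_eq_zero] at htop
          exact htop
        have heq : H = LinearMap.ker ((g : Module.End ℂ (Fin n → ℂ)) - 1) :=
          Submodule.eq_of_le_of_finrank_le hle (by omega)
        refine ⟨(hR g).2 ⟨h1, hg, by rw [← heq, hfH]⟩, heq.symm⟩
    have h1S : (1 : (Module.End ℂ (Fin n → ℂ))ˣ) ∉ S := by
      intro h
      exact ((hR 1).1 (Finset.mem_filter.1 h).1).2.1 rfl
    let F1 : Fintype ↥G := Fintype.subtype (insert 1 S) hmem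
    have h3 := sum_trace_group G H (by
      intro x
      constructor
      · intro hx g hg
        exact hg.2 x hx
      · intro h
        rw [← hk0, hfix]
        exact h r0 ((hmem r0).1 (Finset.mem_insert_of_mem (Finset.mem_filter.2 ⟨hr0, hk0⟩))))
    have h4 : Fintype.card ↥G = S.card + 1 := by
      rw [← Finset.card_insert_of_notMem h1S]
      exact Fintype.card_of_subtype (insert 1 S) hmem
    have h5 := Finset.sum_subtype (p := fun g => g ∈ G) (F := F1) (insert 1 S) hmem
      (fun g => LinearMap.trace ℂ (Fin n → ℂ) (g : Module.End ℂ (Fin n → ℂ)))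
    have h6 : ((n - 1 : ℕ) : ℂ) = (n : ℂ) - 1 := by
      rw [Nat.cast_sub (by omega)]; simp
    rw [Finset.sum_insert h1S] at h5
    rw [hfH, h4, h6] at h3
    have h7 := h5.trans h3
    rw [Units.val_one, LinearMap.trace_one, hfr] at h7
    push_cast at h7
    linear_combination h7
  have hmaps : ∀ r ∈ R, LinearMap.ker ((r : Module.End ℂ (Fin n → ℂ)) - 1) ∈ Rstar := fun r hr =>
    (hRstar _).2 ⟨r, hr, rfl⟩
  have htr : LinearMap.trace ℂ (Fin n → ℂ) A = (R.card : ℂ) * (n - 1) - Rstar.card := by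
    rw [hA, map_sum, ← Finset.sum_fiberwise_of_maps_to hmaps, Finset.sum_congr rfl hH,
      Finset.sum_sub_distrib, ← Finset.sum_mul, Finset.card_eq_sum_card_fiberwise hmaps]
    simp
  have hn0 : (n : ℂ) ≠ 0 := by exact_mod_cast hn.ne'
  have hmval : m = ((R.card : ℂ) * (n - 1) - Rstar.card) / n := by
    have h1 : A = m • (1 : Module.End ℂ (Fin n → ℂ)) := LinearMap.ext fun x => hAm x
    rw [h1, map_smul, LinearMap.trace_one, hfr, smul_eq_mul] at htr
    rw [eq_div_iff hn0, htr]
  let μ : ℕ → ℝ := fun i => (R.card : ℝ) - i * (R.card + Rstar.card) / n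
  have hext : ∀ i, ∑ g ∈ R, extPowHom i g = ((μ i : ℝ) : ℂ) • (1 : Module.End ℂ (⋀[ℂ]^i (Fin n → ℂ))) := by
    intro i
    rw [sum_extPow R (fun g hg => rank_one_form n hn _ ((hR g).1 hg).2.2) (m - R.card) ?_ i]
    · congr 1
      rw [hmval]
      simp only [μ]
      push_cast
      field_simp
      ring
    · intro x
      rw [Finset.sum_sub_distrib, ← LinearMap.sum_apply, ← hA, hAm, sub_smul]
      simp [← Nat.cast_smul_eq_nsmul ℂ]
  have hNC : ∀ l, (Nat.card ↥W : ℝ) * N l =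
      ∑ i ∈ Finset.range (n + 1), (-1 : ℝ) ^ i * (μ i ^ l * n.choose i) := by
    intro l
    apply Complex.ofReal_injective
    push_cast
    rw [hyp l]
    refine Finset.sum_congr rfl fun i _ => ?_
    congr 1
    have h1 := sum_prod_ofFn (extPowHom (R := ℂ) (M := (Fin n → ℂ)) i) R l
    rw [← map_sum]
    refine (congrArg _ h1).trans ?_
    rw [hext, smul_pow, one_pow, map_smul, LinearMap.trace_one, exteriorPower.finrank_eq, hfr,
      smul_eq_mul]
  intro t
  have hW : (Nat.card ↥W : ℝ) ≠ 0 := by exact_mod_cast Nat.card_pos.ne'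
  have hnR : (n : ℝ) ≠ 0 := by exact_mod_cast hn.ne'
  have hsum : HasSum (fun l : ℕ => t ^ l / l.factorial * (N l : ℝ))
      ((1 / (Nat.card ↥W : ℝ)) *
        ∑ i ∈ Finset.range (n + 1), (-1 : ℝ) ^ i * n.choose i * Real.exp (t * μ i)) := by
    have h1 : HasSum (fun l : ℕ => (1 / (Nat.card ↥W : ℝ)) *
        ∑ i ∈ Finset.range (n + 1), (-1 : ℝ) ^ i * n.choose i * ((t * μ i) ^ l / l.factorial))
        ((1 / (Nat.card ↥W : ℝ)) *
        ∑ i ∈ Finset.range (n + 1), (-1 : ℝ) ^ i * n.choose i * Real.exp (t * μ i)) := by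
      apply HasSum.mul_left
      apply hasSum_sum
      intro i _
      apply HasSum.mul_left
      rw [Real.exp_eq_exp_ℝ]
      exact NormedSpace.expSeries_div_hasSum_exp (t * μ i)
    convert h1 using 2 with l
    rw [eq_comm, one_div, inv_mul_eq_iff_eq_mul₀ hW]
    rw [mul_left_comm, hNC l, Finset.mul_sum]
    refine Finset.sum_congr rfl fun i _ => ?_
    rw [mul_pow]; ring
  rw [hsum.tsum_eq]
  congr 1
  rw [sub_eq_neg_add, add_pow]
  refine Finset.sum_congr rfl fun i hi => ?_
  have hi' : i ≤ n := by simpa [Nat.lt_succ_iff] using hi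
  have hexp : Real.exp (t * μ i) =
      Real.exp (i * (-(t * Rstar.card) / n)) * Real.exp ((n - i : ℕ) * (t * R.card / n)) := by
    rw [← Real.exp_add]
    congr 1
    simp only [μ]
    rw [Nat.cast_sub hi']
    field_simp
    ring
  rw [neg_pow (Real.exp _), ← Real.exp_nat_mul, ← Real.exp_nat_mul, hexp]
  ring
end

section
/- Let $(W, S)$ be a Coxeter system with $W$ finite and $S = \{s_1, \ldots, s_n\}$ of cardinality $n \ge 1$, and assume the system is irreducible, i.e., $S$ cannot be partitioned into two nonempty subsets $S_1, S_2$ such that every element of $S_1$ commutes with every element of $S_2$. Let $\mathcal{R} = \{w s w^{-1} : w \in W, s \in S\}$ be the set of reflections of $W$, let $c = s_{\sigma(1)} s_{\sigma(2)} \cdots s_{\sigma(n)}$ be a Coxeter element (the product of all simple reflections, each occurring exactly once, in some order given by a permutation $\sigma$), and for $l \ge 0$ let $N_l = |\{(r_1,\ldots,r_l) \in \mathcal{R}^l : r_1 \cdots r_l = c\}|$. Then for every $l \ge 0$, $|W| \cdot N_l = \sum_{i=0}^{n} (-1)^i \binom{n}{i} \left( \frac{|\mathcal{R}|(n - 2i)}{n}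 \right)^l$. -/
namespace CS8

open CoxeterSystem

section roots

variable {n : ℕ} (M : CoxeterMatrix (Fin n))

/-- Off-diagonal weights of the Coxeter graph. -/
noncomputable def cA (i j : Fin n) : ℝ :=
  if i = j then 0 else 2 * Real.cos (Real.pi / (M i j : ℝ))

lemma cA_symm (i j : Fin n) : cA M i j = cA M j i := by
  unfold cA
  rw [M.symmetric i j]
  simp [eq_comm]

lemma cA_self (i : Fin n) : cA M i i = 0 := by simp [cA]

lemma cos_pi_div_ge {m : ℕ} (h1 : m ≠ 1) (h2 : m ≠ 2) :
    (1 / 2 : ℝ) ≤ Real.cos (Real.pi / (m : ℝ)) := by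
  rcases Nat.eq_zero_or_pos m with rfl | hm
  · simp; norm_num
  · have h3 : 3 ≤ m := by omega
    rw [← Real.cos_pi_div_three]
    have h3' : (3 : ℝ) ≤ m := by exact_mod_cast h3
    apply Real.cos_le_cos_of_nonneg_of_le_pi
    · positivity
    · have := Real.pi_pos; linarith [div_le_self this.le (by norm_num : (1 : ℝ) ≤ 3)]
    · gcongr

lemma cA_eq_zero_or (i j : Fin n) : cA M i j = 0 ∨ 1 ≤ cA M i j := by
  unfold cA
  split_ifs with h
  · simp
  · by_cases h2 : M i j = 2
    · left; simp [h2]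
    · right
      have := cos_pi_div_ge (M.off_diagonal i j h) h2
      linarith

lemma cA_nonneg (i j : Fin n) : 0 ≤ cA M i j := by
  rcases cA_eq_zero_or M i j with h | h <;> linarith

lemma cA_zero_imp {i j : Fin n} (hij : i ≠ j) (h : cA M i j = 0) : M i j = 2 := by
  by_contra h2
  have := cos_pi_div_ge (M.off_diagonal i j hij) h2
  rw [cA, if_neg hij] at h
  linarith

/-- simple roots -/
noncomputable def rt (i : Fin n) : Fin n → ℝ := Pi.single i 1

/-- simple coroots -/
noncomputable def cf (i : Fin n) : Module.Dual ℝ (Fin n → ℝ) :=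
  (2 : ℝ) • LinearMap.proj i - ∑ j, cA M i j • LinearMap.proj j

lemma cf_apply (i : Fin n) (x : Fin n → ℝ) : cf M i x = 2 * x i - ∑ j, cA M i j * x j := by
  simp [cf]

lemma cf_rt (i j : Fin n) : cf M i (rt j) = (if i = j then 2 else 0) - cA M i j := by
  rw [cf_apply]
  simp [rt, Pi.single_apply]

lemma cf_rt_self (i : Fin n) : cf M i (rt i) = 2 := by simp [cf_rt, cA_self]

/-- simple reflections in the geometric representation -/
noncomputable def rfl0 (i : Fin n) : (Fin n → ℝ) ≃ₗ[ℝ] (Fin n → ℝ) :=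
  Module.reflection (cf_rt_self M i)

lemma rfl0_apply (i : Fin n) (x : Fin n → ℝ) : rfl0 M i x = x - cf M i x • rt i :=
  Module.reflection_apply _ _

open Polynomial.Chebyshev in
lemma rfl0_liftable : M.IsLiftable (rfl0 M) := by
  intro i j
  by_cases hij : i = j
  · subst hij
    rw [M.diagonal, pow_one]
    ext x : 1
    exact Module.involutive_reflection (cf_rt_self M i) x
  rcases Nat.eq_zero_or_pos (M i j) with h0 | hpos
  · rw [h0, pow_zero]
  have hij' : j ≠ i := fun h => hij h.symm
  by_cases h2 : M i j = 2
  · have hA : cA M i j = 0 := by simp [cA, h2]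
    have hA' : cA M j i = 0 := by rw [cA_symm, hA]
    have e1 : cf M i (rt j) = 0 := by simp [cf_rt, hA, hij]
    have e2 : cf M j (rt i) = 0 := by simp [cf_rt, hA', hij']
    rw [h2, pow_two]
    ext x : 1
    simp only [LinearEquiv.mul_apply, LinearEquiv.coe_one, id, rfl0_apply, map_sub, map_smul, e1, e2,
      cf_rt_self]
    module
  have h3 : 3 ≤ M i j := by have := M.off_diagonal i j hij; omega
  set m := M i j with hm
  set φ : ℝ := 2 * (Real.pi / m) with hφ
  have hm3 : (3 : ℝ) ≤ m := by exact_mod_cast h3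
  have hsin : Real.sin φ ≠ 0 := by
    apply ne_of_gt
    apply Real.sin_pos_of_pos_of_lt_pi
    · have := Real.pi_pos; positivity
    · rw [hφ]
      have := Real.pi_pos
      rw [← mul_div_assoc, div_lt_iff₀ (by linarith)]
      nlinarith
  have ht : (2 * Real.cos φ : ℝ) = cf M i (rt j) * cf M j (rt i) - 2 := by
    rw [cf_rt, cf_rt, if_neg hij, if_neg hij', cA_symm M j i, cA, if_neg hij, ← hm, hφ,
      Real.cos_two_mul]
    ring
  have hS (k : ℤ) : (S ℝ k).eval (2 * Real.cos φ) = Real.sin ((k + 1) * φ) / Real.sin φ := by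
    rw [eq_div_iff hsin, S_two_mul_real_cos]
  have hmφ : (m : ℝ) * φ = 2 * Real.pi := by
    rw [hφ]; field_simp
  ext z : 1
  rw [rfl0, rfl0, Module.reflection_mul_reflection_pow_apply _ _ m z _ ht]
  rcases Nat.even_or_odd' m with ⟨p, hp | hp⟩
  · have a1 : ((m : ℤ) - 2) / 2 = p - 1 := by omega
    have a2 : ((m : ℤ) - 1) / 2 = p - 1 := by omega
    have hz : (S ℝ ((p : ℤ) - 1)).eval (2 * Real.cos φ) = 0 := by
      rw [hS]
      have : (((p : ℤ) - 1 : ℤ) + 1 : ℝ) * φ = Real.pi := by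
        push_cast
        rw [hp] at hmφ; push_cast at hmφ; linarith
      rw [this]; simp
    rw [a1, a2, hz]
    simp
  · have a1 : ((m : ℤ) - 2) / 2 = p - 1 := by omega
    have a2 : ((m : ℤ) - 1) / 2 = p := by omega
    have a3 : ((m : ℤ) - 3) / 2 = p - 1 := by omega
    have a4 : (m : ℤ) / 2 = p := by omega
    have hz : (S ℝ (p : ℤ)).eval (2 * Real.cos φ) + (S ℝ ((p : ℤ) - 1)).eval (2 * Real.cos φ) = 0 := by
      rw [hS, hS, ← add_div]
      have : (((p : ℤ) - 1 : ℤ) + 1 : ℝ) * φ = 2 * Real.pi - ((p : ℤ) + 1 : ℝ) * φ := by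
        push_cast
        rw [hp] at hmφ; push_cast at hmφ; linarith
      rw [this, Real.sin_two_pi_sub]; simp
    rw [a1, a2, a3, a4, hz]
    simp

variable {M} {W : Type*} [Group W] (cs : CoxeterSystem M W)

/-- geometric representation -/
noncomputable def rep : W →* ((Fin n → ℝ) ≃ₗ[ℝ] (Fin n → ℝ)) :=
  cs.lift ⟨rfl0 M, rfl0_liftable M⟩

lemma rep_simple (i : Fin n) : rep cs (cs.simple i) = rfl0 M i := by
  simp [rep, CoxeterSystem.lift_apply_simple]

lemma rep_simple_apply (i : Fin n) (x : Fin n → ℝ) :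
    rep cs (cs.simple i) x = x - cf M i x • rt i := by
  rw [rep_simple, rfl0_apply]

lemma rep_mul_apply (g h : W) (x : Fin n → ℝ) : rep cs (g * h) x = rep cs g (rep cs h x) := by
  simp [map_mul, LinearEquiv.mul_apply]

/-- The dihedral coefficients. -/
noncomputable def uu (a : ℝ) : ℕ → ℝ
  | 0 => 0
  | 1 => 1
  | (k + 2) => a * uu a (k + 1) - uu a k

lemma uu_sin (θ : ℝ) (k : ℕ) : uu (2 * Real.cos θ) k * Real.sin θ = Real.sin (k * θ) := by
  induction k using Nat.twoStepInduction with
  | zero => simp [uu]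
  | one => simp [uu]
  | more k h1 h2 =>
    rw [uu, sub_mul, mul_assoc, h2, h1]
    push_cast
    have e1 : ((k : ℝ) + 2) * θ = (k + 1) * θ + θ := by ring
    have e2 : (k : ℝ) * θ = (k + 1) * θ - θ := by ring
    rw [e1, e2, Real.sin_add, Real.sin_sub]
    ring

lemma uu_two (k : ℕ) : uu 2 k = k := by
  induction k using Nat.twoStepInduction with
  | zero => simp [uu]
  | one => simp [uu]
  | more k h1 h2 =>
    rw [uu, h2, h1]; push_cast; ring

lemma uu_nonneg {i j : Fin n} (hij : i ≠ j) (k : ℕ) (hk : M i j = 0 ∨ k ≤ M i j) :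
    0 ≤ uu (cA M i j) k := by
  rw [cA, if_neg hij]
  rcases Nat.eq_zero_or_pos (M i j) with h0 | hpos
  · rw [h0]; simp [uu_two]
  · have hk' : k ≤ M i j := by omega
    have h1 := M.off_diagonal i j hij
    have h2 : (2 : ℝ) ≤ M i j := by exact_mod_cast (by omega : 2 ≤ M i j)
    set θ := Real.pi / (M i j : ℝ) with hθ
    have hpi := Real.pi_pos
    have hs : 0 < Real.sin θ := by
      apply Real.sin_pos_of_pos_of_lt_pi
      · positivity
      · rw [hθ, div_lt_iff₀ (by linarith)]; nlinarith
    have := uu_sin θ k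
    have h3 : 0 ≤ Real.sin (k * θ) := by
      apply Real.sin_nonneg_of_nonneg_of_le_pi
      · positivity
      · rw [hθ, ← mul_div_assoc, div_le_iff₀ (by linarith)]
        have : (k : ℝ) ≤ M i j := by exact_mod_cast hk'
        nlinarith
    rw [← this] at h3
    exact nonneg_of_mul_nonneg_left h3 hs

lemma rep_alt {s t : Fin n} (hst : s ≠ t) (k : ℕ) :
    rep cs (cs.wordProd (alternatingWord s t k)) (rt s) =
      uu (cA M s t) (k + 1) • rt (if Even k then s else t) +
      uu (cA M s t) k • rt (if Even k then t else s) := by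
  induction k with
  | zero => simp [alternatingWord, uu]
  | succ k ih =>
    rw [alternatingWord_succ', wordProd_cons, rep_mul_apply, ih]
    have hts : t ≠ s := fun h => hst h.symm
    by_cases hk : Even k
    · have hk' : ¬ Even (k + 1) := by simpa [Nat.even_add_one] using hk
      simp only [hk, hk', if_true, if_false, map_add, map_smul, rep_simple_apply, cf_rt_self]
      rw [cf_rt, if_neg hts, cA_symm M t s, uu]
      module
    · have hk' : Even (k + 1) := by simpa [Nat.even_add_one] using hk
      simp only [hk, hk', if_true, if_false, map_add, map_smul, rep_simple_apply, cf_rt_self]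
      rw [cf_rt, if_neg hst, uu]
      module

/-- nonnegative vectors -/
def Pos (x : Fin n → ℝ) : Prop := ∀ i, 0 ≤ x i

lemma pos_comb {x y : Fin n → ℝ} {a b : ℝ} (hx : Pos x) (hy : Pos y) (ha : 0 ≤ a) (hb : 0 ≤ b) :
    Pos (a • x + b • y) := fun i => by
  have := mul_nonneg ha (hx i)
  have := mul_nonneg hb (hy i)
  simp; linarith

lemma pos_rt (i : Fin n) : Pos (rt i) := fun j => by
  rw [rt, Pi.single_apply]; split_ifs <;> norm_num

/-- Peeling a maximal alternating suffix. -/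
lemma peel (s t : Fin n) (w : W) : ∀ (d : ℕ) (v : W) (k : ℕ), cs.length v = d →
    w = v * cs.wordProd (alternatingWord s t k) → cs.length v + k = cs.length w →
    ¬ cs.IsRightDescent v (if Even k then s else t) →
    ∃ v' k', k ≤ k' ∧ w = v' * cs.wordProd (alternatingWord s t k') ∧
      cs.length v' + k' = cs.length w ∧
      ¬ cs.IsRightDescent v' (if Even k' then s else t) ∧
      ¬ cs.IsRightDescent v' (if Even k' then t else s) := by
  intro d
  induction d with
  | zero =>
    intro v k hv hw hl hx
    refine ⟨v, k, le_rfl, hw, hl, hx, ?_⟩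
    rw [cs.length_eq_zero_iff.1 hv]
    exact cs.not_isRightDescent_one _
  | succ d ih =>
    intro v k hv hw hl hx
    by_cases hy : cs.IsRightDescent v (if Even k then t else s)
    · have hlen := cs.isRightDescent_iff.1 hy
      have := ih (v * cs.simple (if Even k then t else s)) (k + 1) (by omega) (by
        rw [alternatingWord_succ', wordProd_cons, ← mul_assoc, simple_mul_simple_cancel_right, hw])
        (by omega) (by
          have h1 := (cs.isRightDescent_iff_not_isRightDescent_mul).1 hy
          by_cases hk : Even k
          · have hk' : ¬ Even (k + 1) := by simpa [Nat.even_add_one] using hk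
            simpa [hk, hk'] using h1
          · have hk' : Even (k + 1) := by simpa [Nat.even_add_one] using hk
            simpa [hk, hk'] using h1)
      obtain ⟨v', k', h1, h2⟩ := this
      exact ⟨v', k', by omega, h2⟩
    · exact ⟨v, k, le_rfl, hw, hl, hx, hy⟩

theorem pos_of_not_descent : ∀ (d : ℕ) (w : W) (s : Fin n), cs.length w = d →
    ¬ cs.IsRightDescent w s → Pos (rep cs w (rt s)) := by
  intro d
  induction d using Nat.strong_induction_on with
  | _ d ih =>
    intro w s hd hs
    by_cases hw1 : w = 1
    · subst hw1
      simpa using pos_rt s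
    obtain ⟨t, ht⟩ := cs.exists_rightDescent_of_ne_one hw1
    have hst : s ≠ t := by rintro rfl; exact hs ht
    have hlen := cs.isRightDescent_iff.1 ht
    obtain ⟨v, k, hk1, hwv, hl, hx, hy⟩ := peel cs s t w _ (w * cs.simple t) 1 rfl
      (by simp [alternatingWord]) (by omega)
      (by simpa using (cs.isRightDescent_iff_not_isRightDescent_mul).1 ht)
    have hlv : cs.length v < d := by omega
    have hbound : M s t = 0 ∨ k + 1 ≤ M s t := by
      by_contra hcon
      push Not at hcon
      obtain ⟨hm0, hm⟩ := hcon
      -- length of w * s too small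
      obtain ⟨r, hr⟩ : ∃ r, k = r + M s t := ⟨k - M s t, by omega⟩
      have key : ∀ r, ∃ ω : List (Fin n), ω.length = r ∧
          cs.wordProd (alternatingWord s t (r + M s t)) =
            cs.wordProd ω * cs.wordProd (alternatingWord s t (M s t)) := by
        intro r
        induction r with
        | zero => exact ⟨[], rfl, by simp⟩
        | succ r ihr =>
          obtain ⟨ω, h1, h2⟩ := ihr
          refine ⟨(if Even (r + M s t) then t else s) :: ω, by simp [h1], ?_⟩
          rw [show r + 1 + M s t = (r + M s t) + 1 by ring, alternatingWord_succ', wordProd_cons, h2,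
            wordProd_cons, mul_assoc]
      obtain ⟨ω, hω, hprod⟩ := key r
      have hb : cs.wordProd (alternatingWord s t (M s t)) =
          cs.wordProd (alternatingWord s t (M s t - 1)) * cs.simple s := by
        have := cs.wordProd_braidWord_eq s t
        rw [braidWord, braidWord, M.symmetric t s] at this
        rw [this]
        obtain ⟨m', hm'⟩ := Nat.exists_eq_succ_of_ne_zero hm0
        rw [hm', Nat.succ_eq_add_one, alternatingWord_succ, wordProd_concat]
        simp
      have hws : w * cs.simple s = v * cs.wordProd (ω ++ alternatingWord s t (M s t - 1)) := by
        rw [hwv, hr, hprod, hb, wordProd_append]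
        simp [mul_assoc]
      have h1 := cs.length_mul_le v (cs.wordProd (ω ++ alternatingWord s t (M s t - 1)))
      have h2 := cs.length_wordProd_le (ω ++ alternatingWord s t (M s t - 1))
      rw [List.length_append, length_alternatingWord, hω] at h2
      rw [← hws] at h1
      have h3 := cs.not_isRightDescent_iff.1 hs
      omega
    rw [hwv, rep_mul_apply, rep_alt cs hst, map_add, map_smul, map_smul]
    exact pos_comb (ih _ hlv _ _ rfl hx) (ih _ hlv _ _ rfl hy)
      (uu_nonneg hst _ hbound) (uu_nonneg hst _ (by omega))

/-- Sign theorem. -/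
theorem pos_rep {w : W} {s : Fin n} (h : ¬ cs.IsRightDescent w s) : Pos (rep cs w (rt s)) :=
  pos_of_not_descent cs _ w s rfl h

theorem neg_rep {w : W} {s : Fin n} (h : cs.IsRightDescent w s) : Pos (- rep cs w (rt s)) := by
  have h1 := pos_rep cs ((cs.isRightDescent_iff_not_isRightDescent_mul).1 h)
  rw [rep_mul_apply, rep_simple_apply, cf_rt_self] at h1
  have : rt s - (2 : ℝ) • rt s = - rt s := by module
  rwa [this, map_neg] at h1

lemma rt_ne_zero (s : Fin n) : rt s ≠ (0 : Fin n → ℝ) := by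
  intro h
  have := congrFun h s
  simp [rt] at this

lemma rep_rt_ne_zero (w : W) (s : Fin n) : rep cs w (rt s) ≠ 0 := by
  intro h
  exact rt_ne_zero s ((LinearEquiv.map_eq_zero_iff _).1 h)

lemma pos_antisymm {x : Fin n → ℝ} (h1 : Pos x) (h2 : Pos (-x)) : x = 0 := by
  ext i
  have a := h1 i
  have b := h2 i
  simp at b
  simp; linarith

theorem pos_rep_iff {w : W} {s : Fin n} : Pos (rep cs w (rt s)) ↔ ¬ cs.IsRightDescent w s := by
  refine ⟨fun h hd => ?_, pos_rep cs⟩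
  exact rep_rt_ne_zero cs w s (pos_antisymm h (neg_rep cs hd))

theorem neg_rep_iff {w : W} {s : Fin n} : Pos (-rep cs w (rt s)) ↔ cs.IsRightDescent w s := by
  refine ⟨fun h => ?_, neg_rep cs⟩
  by_contra hd
  exact rep_rt_ne_zero cs w s (pos_antisymm (pos_rep cs hd) h)

theorem eq_one_of_no_descent {g : W} (h : ∀ i, Pos (rep cs g (rt i))) : g = 1 := by
  by_contra hg
  obtain ⟨i, hi⟩ := cs.exists_rightDescent_of_ne_one hg
  exact (pos_rep_iff cs).1 (h i) hi

/-- invariant bilinear form -/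
noncomputable def bf (x y : Fin n → ℝ) : ℝ := ∑ i, x i * cf M i y

lemma sum_cA_symm (x y : Fin n → ℝ) :
    ∑ i, x i * ∑ j, cA M i j * y j = ∑ i, y i * ∑ j, cA M i j * x j := by
  simp only [Finset.mul_sum]
  rw [Finset.sum_comm]
  refine Finset.sum_congr rfl fun i _ => Finset.sum_congr rfl fun j _ => ?_
  rw [cA_symm M j i]; ring

lemma bf_symm (x y : Fin n → ℝ) : bf (M := M) x y = bf (M := M) y x := by
  have h := sum_cA_symm (M := M) x y
  unfold bf
  simp only [cf_apply, mul_sub, Finset.sum_sub_distrib]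
  rw [h]
  congr 1
  exact Finset.sum_congr rfl fun i _ => by ring

lemma bf_add_smul (x x' y : Fin n → ℝ) (a : ℝ) :
    bf (M := M) (x - a • x') y = bf (M := M) x y - a * bf (M := M) x' y := by
  unfold bf
  rw [Finset.mul_sum, ← Finset.sum_sub_distrib]
  refine Finset.sum_congr rfl fun i _ => ?_
  simp; ring

lemma bf_rt (i : Fin n) (y : Fin n → ℝ) : bf (M := M) (rt i) y = cf M i y := by
  simp [bf, rt, Pi.single_apply]

lemma bf_simple (i : Fin n) (x y : Fin n → ℝ) :
    bf (M := M) (rep cs (cs.simple i) x) (rep cs (cs.simple i) y) = bf (M := M) x y := by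
  have e : ∀ x y : Fin n → ℝ, bf (M := M) (rep cs (cs.simple i) x) y =
      bf (M := M) x y - cf M i x * cf M i y := fun x y => by
    rw [rep_simple_apply, bf_add_smul, bf_rt]
  rw [e, bf_symm, e, rep_simple_apply, bf_symm (M := M) y x, map_sub, map_smul, cf_rt_self]
  simp; ring

lemma bf_rep (w : W) (x y : Fin n → ℝ) :
    bf (M := M) (rep cs w x) (rep cs w y) = bf (M := M) x y := by
  induction w using cs.simple_induction_left with
  | one => simp
  | mul_simple_left w i ih => rw [rep_mul_apply, rep_mul_apply, bf_simple, ih]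

lemma rep_inv_apply (w : W) (x : Fin n → ℝ) : rep cs w (rep cs w⁻¹ x) = x := by
  rw [← rep_mul_apply]; simp

lemma rep_inv_apply' (w : W) (x : Fin n → ℝ) : rep cs w⁻¹ (rep cs w x) = x := by
  rw [← rep_mul_apply]; simp

/-- If `w α_s = α_t` then `w s w⁻¹ = t`. -/
lemma conj_eq {w : W} {s t : Fin n} (h : rep cs w (rt s) = rt t) :
    w * cs.simple s * w⁻¹ = cs.simple t := by
  have hg : w * cs.simple s * w⁻¹ * cs.simple t = 1 := by
    apply eq_one_of_no_descent cs
    intro i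
    have : rep cs (w * cs.simple s * w⁻¹) = rep cs (cs.simple t) := by
      ext1 x
      rw [rep_mul_apply, rep_mul_apply, rep_simple_apply, map_sub, map_smul, h, rep_inv_apply,
        rep_simple_apply, ← bf_rt, ← bf_rt, ← bf_rep cs w, h, rep_inv_apply]
    rw [rep_mul_apply, this, ← rep_mul_apply]
    simpa using pos_rt i
  rw [mul_eq_one_iff_eq_inv] at hg
  simpa using hg

/-- The crossing lemma. -/
lemma crossing {w : W} {s t : Fin n} (h1 : Pos (rep cs w (rt s)))
    (h2 : ¬ Pos (rep cs (cs.simple t * w) (rt s))) : w * cs.simple s * w⁻¹ = cs.simple t := by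
  apply conj_eq
  have h3 : Pos (-rep cs (cs.simple t * w) (rt s)) :=
    (neg_rep_iff cs).2 (by by_contra h; exact h2 (pos_rep cs h))
  rw [rep_mul_apply, rep_simple_apply] at h3
  set β := rep cs w (rt s) with hβ
  have h4 : β = β t • rt t := by
    ext i
    by_cases hi : i = t
    · subst hi; simp [rt]
    · have a := h1 i
      have b := h3 i
      simp [rt, Pi.single_apply, hi] at b
      simp [rt, Pi.single_apply, hi]
      linarith
  have h5 : bf (M := M) β β = 2 := by rw [hβ, bf_rep, bf_rt, cf_rt_self]
  have h6 : bf (M := M) β β = β t * β t * 2 := by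
    rw [h4]
    have : (β t • rt t : Fin n → ℝ) t = β t := by simp [rt]
    rw [this]
    have e : (β t • rt t : Fin n → ℝ) = 0 - (-β t) • rt t := by module
    have z : ∀ y, bf (M := M) 0 y = 0 := fun y => by simp [bf]
    rw [e, bf_add_smul, z, bf_rt, map_sub, map_smul, cf_rt_self]
    simp
    ring
  have h7 : β t = 1 := by
    have := h1 t
    nlinarith
  rw [h4, h7, one_smul]

end roots

end CS8


namespace CS8

open CoxeterSystem

section longest

variable {n : ℕ} {M : CoxeterMatrix (Fin n)} {W : Type*} [Group W] (cs : CoxeterSystem M W)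

lemma exists_longest [Finite W] : ∃ w0 : W, ∀ i, cs.IsRightDescent w0 i ∧ cs.IsLeftDescent w0 i := by
  obtain ⟨w0, hw0⟩ := Finite.exists_max cs.length
  refine ⟨w0, fun i => ⟨?_, ?_⟩⟩
  · by_contra h
    have := cs.not_isRightDescent_iff.1 h
    have := hw0 (w0 * cs.simple i)
    omega
  · by_contra h
    have := cs.not_isLeftDescent_iff.1 h
    have := hw0 (cs.simple i * w0)
    omega

lemma rep_nonneg_comb {g : W} {x : Fin n → ℝ} (hx : Pos x) (h : ∀ i, Pos (rep cs g (rt i))) :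
    Pos (rep cs g x) := by
  have e : x = ∑ i, x i • rt i := by
    ext j; simp [rt, Pi.single_apply, Finset.sum_apply]
  rw [e, map_sum]
  intro j
  rw [Finset.sum_apply]
  refine Finset.sum_nonneg fun i _ => ?_
  rw [map_smul]
  exact mul_nonneg (hx i) (h i j)

lemma longest_unique_right {w w' : W} (h : ∀ i, cs.IsRightDescent w i)
    (h' : ∀ i, cs.IsLeftDescent w' i) : w' = w := by
  have : w'⁻¹ * w = 1 := by
    apply eq_one_of_no_descent cs
    intro i
    rw [rep_mul_apply]
    have e : rep cs w'⁻¹ (rep cs w (rt i)) = - rep cs w'⁻¹ (-rep cs w (rt i)) := by simp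
    rw [e]
    have h1 := (neg_rep_iff cs).2 (h i)
    have h2 : ∀ j, Pos (-rep cs w'⁻¹ (rt j)) := fun j =>
      (neg_rep_iff cs).2 (by rw [isRightDescent_inv_iff]; exact h' j)
    set x := -rep cs w (rt i) with hx
    have e : x = ∑ i, x i • rt i := by
      ext j; simp [rt, Pi.single_apply, Finset.sum_apply]
    rw [e, map_sum, ← Finset.sum_neg_distrib]
    intro j
    rw [Finset.sum_apply]
    refine Finset.sum_nonneg fun k _ => ?_
    rw [map_smul, ← smul_neg]
    exact mul_nonneg (h1 k) (h2 k j)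
  exact (inv_mul_eq_one.1 this)

lemma length_longest [Finite W] {w0 : W} (h0 : ∀ i, cs.IsRightDescent w0 i ∧ cs.IsLeftDescent w0 i)
    (w : W) : cs.length (w⁻¹ * w0) + cs.length w = cs.length w0 := by
  obtain ⟨wm, hwm⟩ := Finite.exists_max cs.length
  have key : ∀ (d : ℕ) (w : W), cs.length wm - cs.length w = d →
      cs.length (w⁻¹ * w0) + cs.length w = cs.length w0 := by
    intro d
    induction d with
    | zero =>
      intro w hw
      have hmax : ∀ u, cs.length u ≤ cs.length w := fun u => by have := hwm u; omega
      have : w0 = w := longest_unique_right cs (w := w) (fun i => by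
        by_contra h
        have := cs.not_isRightDescent_iff.1 h
        have := hmax (w * cs.simple i)
        omega) (fun i => (h0 i).2)
      subst this
      simp
    | succ d ih =>
      intro w hw
      by_cases hall : ∀ i, cs.IsRightDescent w i
      · have : w0 = w := longest_unique_right cs hall (fun i => (h0 i).2)
        subst this
        simp
      push Not at hall
      obtain ⟨i, hi⟩ := hall
      have h1 := cs.not_isRightDescent_iff.1 hi
      have h2 := ih (w * cs.simple i) (by omega)
      have h3 : w⁻¹ * w0 = cs.simple i * ((w * cs.simple i)⁻¹ * w0) := by
        simp [mul_assoc]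
      have h4 := cs.length_mul_le (cs.simple i) ((w * cs.simple i)⁻¹ * w0)
      rw [← h3, length_simple] at h4
      have h5 := cs.length_mul_le w (w⁻¹ * w0)
      rw [mul_inv_cancel_left] at h5
      omega
  exact key _ w rfl

/-- conjugation by the longest element permutes simple reflections -/
lemma longest_conj [Finite W] {w0 : W} (h0 : ∀ i, cs.IsRightDescent w0 i ∧ cs.IsLeftDescent w0 i)
    (i : Fin n) : ∃ j, cs.simple i * w0 = w0 * cs.simple j := by
  have h1 := cs.isLeftDescent_iff.1 (h0 i).2
  have h2 := length_longest cs h0 (cs.simple i * w0)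
  have h3 : cs.length ((cs.simple i * w0)⁻¹ * w0) = 1 := by omega
  obtain ⟨j, hj⟩ := cs.length_eq_one_iff.1 h3
  refine ⟨j, ?_⟩
  rw [← hj]
  simp [mul_assoc]

end longest

section PF

open Matrix

theorem exists_pf {n : ℕ} (hn : 1 ≤ n) (A : Matrix (Fin n) (Fin n) ℝ) (hsymm : Aᵀ = A)
    (hpos : ∀ i j, 0 ≤ A i j)
    (hirr : ∀ P : Set (Fin n), P.Nonempty → Pᶜ.Nonempty → ∃ i ∈ P, ∃ j ∈ Pᶜ, A i j ≠ 0) :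
    ∃ (η : Fin n → ℝ) (τ : ℝ), (∀ i, 0 < η i) ∧ ∀ i, ∑ j, A i j * η j = τ * η i := by
  set q : (Fin n → ℝ) → ℝ := fun x => x ⬝ᵥ (A *ᵥ x) with hq
  set K : Set (Fin n → ℝ) := {x | x ⬝ᵥ x = 1} with hK
  have hcompact : IsCompact K := by
    refine (isCompact_univ_pi (fun _ : Fin n => isCompact_Icc (a := (-1 : ℝ)) (b := 1))).of_isClosed_subset ?_ ?_
    · refine isClosed_eq ?_ continuous_const
      unfold dotProduct
      fun_prop
    · intro x hx i _
      have h1 : x i * x i ≤ x ⬝ᵥ x :=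
        Finset.single_le_sum (f := fun j => x j * x j) (fun j _ => mul_self_nonneg _) (Finset.mem_univ i)
      rw [show x ⬝ᵥ x = 1 from hx] at h1
      exact ⟨by nlinarith, by nlinarith⟩
  have hne : K.Nonempty := ⟨Pi.single ⟨0, hn⟩ 1, by simp [hK]⟩
  have hcont : Continuous q := by
    simp only [hq, dotProduct, mulVec]
    fun_prop
  obtain ⟨x, hxK, hxmax⟩ := hcompact.exists_isMaxOn hne hcont.continuousOn
  set y : Fin n → ℝ := fun i => |x i| with hy
  set τ := q x with hτ
  have hyK : y ⬝ᵥ y = 1 := by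
    rw [← show x ⬝ᵥ x = 1 from hxK]
    simp [dotProduct, hy, abs_mul_abs_self]
  have hle : ∀ z : Fin n → ℝ, q z ≤ τ * (z ⬝ᵥ z) := by
    intro z
    have hz0 : 0 ≤ z ⬝ᵥ z := Finset.sum_nonneg fun i _ => mul_self_nonneg _
    rcases hz0.eq_or_lt with h | h
    · have : z = 0 := dotProduct_self_eq_zero.1 h.symm
      simp [this, hq]
    · set r := Real.sqrt (z ⬝ᵥ z) with hr
      have hr2 : r * r = z ⬝ᵥ z := Real.mul_self_sqrt hz0
      have hrpos : 0 < r := Real.sqrt_pos.2 h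
      have h1 : (r⁻¹ • z) ∈ K := by
        simp only [hK, Set.mem_setOf_eq, smul_dotProduct, dotProduct_smul, ← hr2, smul_eq_mul]
        field_simp
      have h2 : q (r⁻¹ • z) ≤ τ := hxmax h1
      have h3 : q (r⁻¹ • z) = r⁻¹ * (r⁻¹ * q z) := by
        simp [hq, mulVec_smul, smul_dotProduct, dotProduct_smul]
      rw [h3] at h2
      have : q z = r * r * (r⁻¹ * (r⁻¹ * q z)) := by field_simp
      rw [this, hr2, mul_comm τ]
      exact mul_le_mul_of_nonneg_left h2 hz0
  have hqy : τ ≤ q y := by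
    simp only [hτ, hq, dotProduct, mulVec, Finset.mul_sum]
    refine Finset.sum_le_sum fun i _ => Finset.sum_le_sum fun j _ => ?_
    calc x i * (A i j * x j) = A i j * (x i * x j) := by ring
      _ ≤ A i j * |x i * x j| := mul_le_mul_of_nonneg_left (le_abs_self _) (hpos i j)
      _ = _ := by rw [abs_mul]; ring
  have hqy' : q y = τ := le_antisymm (by simpa [hyK] using hle y) hqy
  have hsw : ∀ u v : Fin n → ℝ, u ⬝ᵥ (A *ᵥ v) = v ⬝ᵥ (A *ᵥ u) := by
    intro u v
    rw [dotProduct_mulVec, ← mulVec_transpose, hsymm, dotProduct_comm]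
  have heig : ∀ i, ∑ j, A i j * y j = τ * y i := by
    intro i
    set z : Fin n → ℝ := Pi.single i 1 with hz
    have hv : ∀ t : ℝ, 2 * t * ((A *ᵥ y) i - τ * y i) + t ^ 2 * (q z - τ) ≤ 0 := by
      intro t
      have h := hle (y + t • z)
      have e1 : q (y + t • z) = q y + 2 * t * (A *ᵥ y) i + t ^ 2 * q z := by
        simp only [hq, mulVec_add, mulVec_smul, dotProduct_add, add_dotProduct, smul_dotProduct,
          dotProduct_smul, smul_eq_mul]
        rw [hsw y z]
        have : z ⬝ᵥ A *ᵥ y = (A *ᵥ y) i := by simp [hz]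
        rw [this]; ring
      have e2 : (y + t • z) ⬝ᵥ (y + t • z) = 1 + 2 * t * y i + t ^ 2 := by
        simp only [dotProduct_add, add_dotProduct, smul_dotProduct, dotProduct_smul, smul_eq_mul, hyK]
        simp [hz]; ring
      rw [e1, e2, hqy'] at h
      nlinarith
    set a := (A *ᵥ y) i - τ * y i with ha
    set b := q z - τ with hb
    have : a = 0 := by
      by_contra hne
      have hbp : 0 < |b| + 1 := by positivity
      have h := hv (a / (|b| + 1))
      have e : 2 * (a / (|b| + 1)) * a + (a / (|b| + 1)) ^ 2 * b
        = (a ^ 2 / (|b| + 1) ^ 2) * (2 * (|b| + 1) + b) := by field_simp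
      rw [e] at h
      have h1 : 0 < a ^ 2 / (|b| + 1) ^ 2 := by positivity
      have h2 : 0 < 2 * (|b| + 1) + b := by have := neg_abs_le b; have := abs_nonneg b; linarith
      have := mul_pos h1 h2
      linarith
    have e : (A *ᵥ y) i = ∑ j, A i j * y j := rfl
    rw [← e]; linarith
  refine ⟨y, τ, ?_, heig⟩
  intro i
  by_contra hi
  have hi0 : y i = 0 := le_antisymm (not_lt.1 hi) (abs_nonneg _)
  obtain ⟨a, ha, b, hb, hab⟩ := hirr {i | y i = 0} ⟨i, hi0⟩ (by
    by_contra hempty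
    rw [Set.not_nonempty_iff_eq_empty, Set.compl_empty_iff] at hempty
    have : y = 0 := by
      ext j
      have : j ∈ {i | y i = 0} := by rw [hempty]; trivial
      exact this
    rw [this] at hyK; simp at hyK)
  have h1 := heig a
  rw [show y a = 0 from ha, mul_zero] at h1
  have h2 := (Finset.sum_eq_zero_iff_of_nonneg (fun j _ => mul_nonneg (hpos a j) (abs_nonneg _))).1 h1 b
    (Finset.mem_univ b)
  rcases mul_eq_zero.1 h2 with h | h
  · exact hab h
  · exact hb h

end PF

section graph

variable {n : ℕ} {M : CoxeterMatrix (Fin n)} {W : Type*} [Group W] (cs : CoxeterSystem M W)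

lemma commute_of_cA {i j : Fin n} (h : cA M i j = 0) : Commute (cs.simple i) (cs.simple j) := by
  by_cases hij : i = j
  · subst hij; exact Commute.refl _
  · have h2 := cA_zero_imp M hij h
    have h3 := cs.simple_mul_simple_pow i j
    rw [h2, pow_two] at h3
    have h4 := mul_eq_one_iff_eq_inv.1 h3
    rw [mul_inv_rev, inv_simple, inv_simple] at h4
    exact h4

lemma exists_eta (hn : 1 ≤ n)
    (hirr : ¬ ∃ P : Set (Fin n), P.Nonempty ∧ Pᶜ.Nonempty ∧
      ∀ i ∈ P, ∀ j ∈ Pᶜ, Commute (cs.simple i) (cs.simple j)) :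
    ∃ (η : Fin n → ℝ) (τ : ℝ), (∀ i, 0 < η i) ∧ ∀ i, ∑ j, cA M i j * η j = τ * η i := by
  refine exists_pf hn (Matrix.of fun i j => cA M i j) ?_ (fun i j => cA_nonneg M i j) ?_
  · ext i j; exact cA_symm M j i
  · intro P h1 h2
    by_contra hcon
    push Not at hcon
    exact hirr ⟨P, h1, h2, fun i hi j hj => commute_of_cA cs (hcon i hi j hj)⟩

lemma tau_lt_two {W : Type*} [Group W] [Finite W] (cs : CoxeterSystem M W)
    (hn : 1 ≤ n) {η : Fin n → ℝ} {τ : ℝ} (hη : ∀ i, 0 < η i)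
    (h : ∀ i, ∑ j, cA M i j * η j = τ * η i) : τ < 2 := by
  by_contra hτ
  push Not at hτ
  obtain ⟨w0, hw0⟩ := exists_longest cs
  have key : ∀ w : W, Pos (rep cs w η - η) := by
    intro w
    induction hd : cs.length w generalizing w with
    | zero => rw [cs.length_eq_zero_iff.1 hd]; intro i; simp
    | succ d ih =>
      have hw1 : w ≠ 1 := by rintro rfl; simp at hd
      obtain ⟨i, hi⟩ := cs.exists_rightDescent_of_ne_one hw1
      have hlen := cs.isRightDescent_iff.1 hi
      have h1 := ih (w * cs.simple i) (by omega)
      have h2 := pos_rep cs ((cs.isRightDescent_iff_not_isRightDescent_mul).1 hi)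
      have e : rep cs w η = rep cs (w * cs.simple i) η +
          ((τ - 2) * η i) • rep cs (w * cs.simple i) (rt i) := by
        have : w = (w * cs.simple i) * cs.simple i := by simp
        conv_lhs => rw [this]
        rw [rep_mul_apply, rep_simple_apply cs i η, cf_apply, h i, map_sub, map_smul]
        module
      intro j
      have a := h1 j
      have b := mul_nonneg (mul_nonneg (sub_nonneg.2 hτ) (hη i).le) (h2 j)
      rw [e]
      simp only [Pi.sub_apply, Pi.add_apply, Pi.smul_apply, smul_eq_mul, zero_sub] at a ⊢
      linarith
  have h1 := key w0
  have h2 : Pos (-rep cs w0 η) := by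
    have e : η = ∑ i, η i • rt i := by
      ext j; simp [rt, Pi.single_apply, Finset.sum_apply]
    rw [e, map_sum, ← Finset.sum_neg_distrib]
    intro j
    rw [Finset.sum_apply]
    refine Finset.sum_nonneg fun k _ => ?_
    rw [map_smul, ← smul_neg]
    exact mul_nonneg (hη k).le ((neg_rep_iff cs).2 (hw0 k).1 j)
  have a := h1 ⟨0, hn⟩
  have b := h2 ⟨0, hn⟩
  have c := hη ⟨0, hn⟩
  simp at a b
  linarith

lemma exists_leaf {η : Fin n → ℝ} {τ : ℝ} (hη : ∀ i, 0 < η i)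
    (h : ∀ i, ∑ j, cA M i j * η j = τ * η i) (hτ : τ < 2) (S : Finset (Fin n)) (hS : S.Nonempty) :
    ∃ p ∈ S, ∀ x ∈ S, ∀ y ∈ S, cA M p x ≠ 0 → cA M p y ≠ 0 → x = y := by
  by_contra hcon
  push Not at hcon
  have hrow : ∀ p ∈ S, 2 ≤ ∑ j ∈ S, cA M p j := by
    intro p hp
    obtain ⟨x, hx, y, hy, h1, h2, hxy⟩ := hcon p hp
    have a : 1 ≤ cA M p x := (cA_eq_zero_or M p x).resolve_left h1
    have b : 1 ≤ cA M p y := (cA_eq_zero_or M p y).resolve_left h2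
    calc (2 : ℝ) ≤ cA M p x + cA M p y := by linarith
      _ = ∑ j ∈ {x, y}, cA M p j := by rw [Finset.sum_pair hxy]
      _ ≤ _ := Finset.sum_le_sum_of_subset_of_nonneg (by
          intro z hz; simp at hz; rcases hz with rfl | rfl <;> assumption)
          (fun i _ _ => cA_nonneg M p i)
  have h1 : ∑ i ∈ S, ∑ j ∈ S, cA M i j * (η j / η i) < ∑ i ∈ S, (2 : ℝ) := by
    apply Finset.sum_lt_sum_of_nonempty hS
    intro i _
    have : ∑ j ∈ S, cA M i j * (η j / η i) = (∑ j ∈ S, cA M i j * η j) / η i := by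
      rw [Finset.sum_div]; exact Finset.sum_congr rfl fun j _ => by ring
    rw [this, div_lt_iff₀ (hη i)]
    calc ∑ j ∈ S, cA M i j * η j ≤ ∑ j, cA M i j * η j :=
          Finset.sum_le_sum_of_subset_of_nonneg (Finset.subset_univ _)
            (fun j _ _ => mul_nonneg (cA_nonneg M i j) (hη j).le)
      _ = τ * η i := h i
      _ < _ := mul_lt_mul_of_pos_right hτ (hη i)
  have h2 : ∑ i ∈ S, (2 : ℝ) ≤ ∑ i ∈ S, ∑ j ∈ S, cA M i j := Finset.sum_le_sum hrow
  have h3 : ∑ i ∈ S, ∑ j ∈ S, cA M i j * (η j / η i) = ∑ i ∈ S, ∑ j ∈ S, cA M i j * (η i / η j) := by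
    rw [Finset.sum_comm]
    exact Finset.sum_congr rfl fun i _ => Finset.sum_congr rfl fun j _ => by rw [cA_symm M j i]
  have h4 : ∑ i ∈ S, ∑ j ∈ S, 2 * cA M i j ≤
      ∑ i ∈ S, ∑ j ∈ S, cA M i j * (η j / η i) + ∑ i ∈ S, ∑ j ∈ S, cA M i j * (η i / η j) := by
    rw [← Finset.sum_add_distrib]
    refine Finset.sum_le_sum fun i _ => ?_
    rw [← Finset.sum_add_distrib]
    refine Finset.sum_le_sum fun j _ => ?_
    rw [← mul_add, mul_comm]
    apply mul_le_mul_of_nonneg_left _ (cA_nonneg M i j)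
    have a := hη i
    have b := hη j
    rw [div_add_div _ _ a.ne' b.ne', le_div_iff₀ (by positivity)]
    nlinarith [sq_nonneg (η i - η j)]
  simp only [← Finset.mul_sum] at h4
  linarith

/-- Conjugation moves on words. -/
inductive CR (M : CoxeterMatrix (Fin n)) : List (Fin n) → List (Fin n) → Prop
  | refl (a) : CR M a a
  | symm {a b} : CR M a b → CR M b a
  | trans {a b c} : CR M a b → CR M b c → CR M a c
  | swap (a b x y) : cA M x y = 0 → CR M (a ++ x :: y :: b) (a ++ y :: x :: b)
  | rot (x v) : CR M (x :: v) (v ++ [x])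

lemma CR.perm {u v : List (Fin n)} (h : CR M u v) : u.Perm v := by
  induction h with
  | refl => exact List.Perm.refl _
  | symm _ ih => exact ih.symm
  | trans _ _ ih1 ih2 => exact ih1.trans ih2
  | swap a b x y _ => exact (List.Perm.swap y x b).append_left a
  | rot x v => exact (List.perm_append_singleton x v).symm

lemma CR.isConj {u v : List (Fin n)} (h : CR M u v) :
    IsConj (cs.wordProd u) (cs.wordProd v) := by
  induction h with
  | refl => exact IsConj.refl _
  | symm _ ih => exact ih.symm
  | trans _ _ ih1 ih2 => exact ih1.trans ih2
  | swap a b x y h =>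
    have := (commute_of_cA cs h).eq
    simp only [wordProd_append, wordProd_cons]
    rw [← mul_assoc (cs.simple x), this, mul_assoc]
  | rot x v =>
    rw [wordProd_append, wordProd_cons, wordProd_singleton]
    exact isConj_iff.2 ⟨cs.simple x, by simp [mul_assoc]⟩

lemma CR.rotate (a b : List (Fin n)) : CR M (a ++ b) (b ++ a) := by
  induction a generalizing b with
  | nil => simpa using CR.refl b
  | cons x a ih =>
    have h1 := CR.rot (M := M) x (a ++ b)
    have h2 := ih (b ++ [x])
    simp only [List.cons_append, List.append_assoc] at h1 h2 ⊢
    exact h1.trans h2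

lemma CR.moveLeft (c v : List (Fin n)) (p : Fin n) (h : ∀ y ∈ v, cA M p y = 0) :
    CR M (c ++ v ++ [p]) (c ++ p :: v) := by
  induction v generalizing c with
  | nil => simpa using CR.refl _
  | cons y v ih =>
    have h1 := ih (c ++ [y]) (fun z hz => h z (List.mem_cons_of_mem _ hz))
    have h2 := CR.swap (M := M) c v y p (by rw [cA_symm]; exact h y (by simp))
    simp only [List.append_assoc, List.cons_append, List.nil_append] at h1 h2 ⊢
    exact h1.trans h2

lemma CR.lift {u v : List (Fin n)} (h : CR M u v) (p : Fin n) (hu : u.Nodup)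
    (hp : ∀ x ∈ u, ∀ y ∈ u, cA M p x ≠ 0 → cA M p y ≠ 0 → x = y) :
    CR M (u ++ [p]) (v ++ [p]) := by
  induction h with
  | refl => exact CR.refl _
  | symm h ih =>
    have hP := h.perm
    exact (ih (hP.nodup_iff.2 hu) (fun x hx y hy => hp x (hP.subset hx) y (hP.subset hy))).symm
  | trans h1 h2 ih1 ih2 =>
    have hP := h1.perm
    exact (ih1 hu hp).trans (ih2 (hP.nodup_iff.1 hu)
      (fun x hx y hy => hp x (hP.symm.subset hx) y (hP.symm.subset hy)))
  | swap a b x y h =>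
    have := CR.swap a (b ++ [p]) x y h
    simpa using this
  | rot x v =>
    by_cases hx : cA M p x = 0
    · have h1 := CR.rot (M := M) x (v ++ [p])
      have h2 := CR.swap (M := M) v [] p x hx
      simp only [List.append_assoc, List.cons_append, List.nil_append] at h1 h2 ⊢
      exact h1.trans h2
    · have hv : ∀ y ∈ v, cA M p y = 0 := by
        intro y hy
        by_contra hne
        have := hp x (by simp) y (by simp [hy]) hx hne
        subst this
        exact (List.nodup_cons.1 hu).1 hy
      have h1 := CR.moveLeft [x] v p hv
      have h2 := CR.rotate (M := M) [x, p] v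
      simp only [List.append_assoc, List.cons_append, List.nil_append] at h1 h2 ⊢
      exact h1.trans h2

theorem CR_of_perm
    (hleaf : ∀ S : Finset (Fin n), S.Nonempty →
      ∃ p ∈ S, ∀ x ∈ S, ∀ y ∈ S, cA M p x ≠ 0 → cA M p y ≠ 0 → x = y) :
    ∀ (d : ℕ) (l l' : List (Fin n)), l.length = d → l.Nodup → l.Perm l' → CR M l l' := by
  intro d
  induction d with
  | zero =>
    intro l l' hl _ hP
    rw [List.length_eq_zero_iff] at hl
    subst hl
    rw [List.nil_perm.1 hP]
    exact CR.refl _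
  | succ d ih =>
    intro l l' hl hnd hP
    have hne : l.toFinset.Nonempty := by
      rw [List.toFinset_nonempty_iff]; rintro rfl; simp at hl
    obtain ⟨p, hp, hpl⟩ := hleaf _ hne
    rw [List.mem_toFinset] at hp
    obtain ⟨a, b, rfl⟩ := List.append_of_mem hp
    obtain ⟨a', b', rfl⟩ := List.append_of_mem (hP.subset hp)
    have c1 : CR M (a ++ p :: b) ((b ++ a) ++ [p]) := by
      have := CR.rotate (M := M) (a ++ [p]) b
      simpa using this
    have c2 : CR M (a' ++ p :: b') ((b' ++ a') ++ [p]) := by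
      have := CR.rotate (M := M) (a' ++ [p]) b'
      simpa using this
    have hP2 : (b ++ a).Perm (b' ++ a') := by
      have h1 : (b ++ a ++ [p]).Perm (b' ++ a' ++ [p]) := c1.perm.symm.trans (hP.trans c2.perm)
      exact (List.perm_append_right_iff _).1 h1
    have hnd2 : (b ++ a ++ [p]).Nodup := c1.perm.nodup_iff.1 hnd
    have hnd3 : (b ++ a).Nodup := (List.nodup_append.1 hnd2).1
    have hmem : ∀ x ∈ b ++ a, x ∈ (a ++ p :: b).toFinset := by
      intro x hx; simp at hx ⊢; tauto
    have hlen : (b ++ a).length = d := by simp at hl ⊢; omega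
    exact c1.trans (((ih _ _ hlen hnd3 hP2).lift p hnd3
      (fun x hx y hy => hpl x (hmem x hx) y (hmem y hy))).trans c2.symm)

theorem exists_coloring
    (hleaf : ∀ S : Finset (Fin n), S.Nonempty →
      ∃ p ∈ S, ∀ x ∈ S, ∀ y ∈ S, cA M p x ≠ 0 → cA M p y ≠ 0 → x = y) :
    ∃ col : Fin n → Bool, ∀ i j, cA M i j ≠ 0 → col i ≠ col j := by
  have key : ∀ (d : ℕ) (S : Finset (Fin n)), S.card = d →
      ∃ col : Fin n → Bool, ∀ i ∈ S, ∀ j ∈ S, cA M i j ≠ 0 → col i ≠ col j := by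
    intro d
    induction d with
    | zero =>
      intro S hS
      rw [Finset.card_eq_zero] at hS
      subst hS
      exact ⟨fun _ => true, by simp⟩
    | succ d ih =>
      intro S hS
      obtain ⟨p, hp, hpl⟩ := hleaf S (Finset.card_pos.1 (by omega))
      obtain ⟨col, hcol⟩ := ih (S.erase p) (by rw [Finset.card_erase_of_mem hp]; omega)
      obtain ⟨b, hb⟩ : ∃ b : Bool, ∀ x ∈ S, x ≠ p → cA M p x ≠ 0 → b ≠ col x := by
        by_cases hex : ∃ x ∈ S, cA M p x ≠ 0
        · obtain ⟨x, hx, hx0⟩ := hex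
          refine ⟨!(col x), fun y hy _ hy0 => ?_⟩
          rw [hpl y hy x hx hy0 hx0]; simp
        · push Not at hex
          exact ⟨true, fun x hx _ h0 => absurd (hex x hx) h0⟩
      refine ⟨Function.update col p b, fun i hi j hj hij => ?_⟩
      by_cases hip : i = p
      · by_cases hjp : j = p
        · subst hip; subst hjp; exact absurd (cA_self M _) hij
        · subst hip
          simpa [Function.update_of_ne hjp] using hb j hj hjp hij
      · by_cases hjp : j = p
        · subst hjp
          simpa [Function.update_of_ne hip] using (hb i hi hip (by rwa [cA_symm])).symm
        · simpa [Function.update_of_ne hip, Function.update_of_ne hjp] using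
            hcol i (Finset.mem_erase.2 ⟨hip, hi⟩) j (Finset.mem_erase.2 ⟨hjp, hj⟩) hij
  obtain ⟨col, h⟩ := key _ Finset.univ rfl
  exact ⟨col, fun i j => h i (Finset.mem_univ i) j (Finset.mem_univ j)⟩

end graph

end CS8


namespace CS8

section analytic

open Matrix Polynomial Filter Topology

/-! ### exponential sums -/

lemma exp_sum_deriv {γ : Type*} (S : Finset γ) (c b : γ → ℝ) (l : ℕ) (u : ℝ) :
      HasDerivAt (fun u => ∑ x ∈ S, c x * b x ^ l * Real.exp (u * b x))
        (∑ x ∈ S, c x * b x ^ (l + 1) * Real.exp (u * b x)) u := by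
  apply HasDerivAt.fun_sum
  intro x _
  have h1 : HasDerivAt (fun u : ℝ => u * b x) (b x) u := by
    simpa using (hasDerivAt_id u).mul_const (b x)
  have h2 := (h1.exp).const_mul (c x * b x ^ l)
  have e : c x * b x ^ (l + 1) * Real.exp (u * b x) =
      c x * b x ^ l * (Real.exp (u * b x) * b x) := by ring
  rw [e]
  exact h2

lemma exp_sum_eq {α β : Type*} (S : Finset α) (T : Finset β) (c b : α → ℝ) (c' b' : β → ℝ)
    (h : ∀ u : ℝ, 0 < u → ∑ x ∈ S, c x * Real.exp (u * b x) = ∑ y ∈ T, c' y * Real.exp (u * b' y))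
    (l : ℕ) : ∑ x ∈ S, c x * b x ^ l = ∑ y ∈ T, c' y * b' y ^ l := by
  have key : ∀ l : ℕ, ∀ u : ℝ, 0 < u → ∑ x ∈ S, c x * b x ^ l * Real.exp (u * b x) =
      ∑ y ∈ T, c' y * b' y ^ l * Real.exp (u * b' y) := by
    intro l
    induction l with
    | zero => simpa using h
    | succ l ih =>
      intro u hu
      refine (exp_sum_deriv S c b l u).unique ?_
      refine (exp_sum_deriv T c' b' l u).congr_of_eventuallyEq ?_
      filter_upwards [lt_mem_nhds hu] with v hv using ih v hv
  have h1 := (exp_sum_deriv S c b l 0).continuousAt.tendsto.mono_left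
    (nhdsWithin_le_nhds (s := Set.Ioi (0 : ℝ)))
  have h2 := (exp_sum_deriv T c' b' l 0).continuousAt.tendsto.mono_left
    (nhdsWithin_le_nhds (s := Set.Ioi (0 : ℝ)))
  have h3 := tendsto_nhds_unique_of_eventuallyEq h1 h2 (by
    filter_upwards [self_mem_nhdsWithin] with u hu using key l u hu)
  simpa using h3

/-! ### roots of the characteristic polynomial -/

lemma root_of_charpoly {ι : Type*} [Fintype ι] [DecidableEq ι] {A : Matrix ι ι ℂ} {r : ℂ}
    (hr : r ∈ A.charpoly.roots) : ∃ v : ι → ℂ, v ≠ 0 ∧ A *ᵥ v = r • v := by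
  have h := Polynomial.isRoot_of_mem_roots hr
  rw [Polynomial.IsRoot, Matrix.eval_charpoly] at h
  obtain ⟨v, hv, h⟩ := Matrix.exists_mulVec_eq_zero_iff.2 h
  refine ⟨v, hv, ?_⟩
  rw [Matrix.sub_mulVec, sub_eq_zero] at h
  rw [← h]
  ext i
  simp [Matrix.scalar_apply, Matrix.mulVec_diagonal]

lemma pow_mulVec {ι : Type*} [Fintype ι] [DecidableEq ι] {A : Matrix ι ι ℂ} {r : ℂ}
    {v : ι → ℂ} (h : A *ᵥ v = r • v) (k : ℕ) : (A ^ k) *ᵥ v = r ^ k • v := by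
  induction k with
  | zero => simp
  | succ k ih => rw [pow_succ, ← Matrix.mulVec_mulVec, h, Matrix.mulVec_smul, ih, smul_smul, pow_succ,
      mul_comm]

lemma card_roots_charpoly {ι : Type*} [Fintype ι] [DecidableEq ι] (A : Matrix ι ι ℂ) :
    Multiset.card A.charpoly.roots = Fintype.card ι := by
  rw [← (IsAlgClosed.splits A.charpoly).natDegree_eq_card_roots, Matrix.charpoly_natDegree_eq_dim]

lemma multiset_norm {u : ℝ} (s : Multiset ℂ)
    (h : ∀ r ∈ s, ‖r‖ = Real.exp u ∨ ‖r‖ = Real.exp (-u)) :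
    ∃ k : ℤ, |k| ≤ Multiset.card s ∧ ‖s.prod‖ = Real.exp (u * k) := by
  induction s using Multiset.induction_on with
  | empty => exact ⟨0, by simp⟩
  | cons r s ih =>
    obtain ⟨k, hk, hp⟩ := ih (fun r hr => h r (Multiset.mem_cons_of_mem hr))
    rcases h r (Multiset.mem_cons_self _ _) with h1 | h1
    · refine ⟨k + 1, ?_, ?_⟩
      · rw [Multiset.card_cons]; push_cast
        rw [abs_le] at hk ⊢; omega
      · rw [Multiset.prod_cons, norm_mul, hp, h1, ← Real.exp_add]; push_cast; ring_nf
    · refine ⟨k - 1, ?_, ?_⟩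
      · rw [Multiset.card_cons]; push_cast
        rw [abs_le] at hk ⊢; omega
      · rw [Multiset.prod_cons, norm_mul, hp, h1, ← Real.exp_add]; push_cast; ring_nf

lemma det_quadratic {ι : Type*} [Fintype ι] [DecidableEq ι] (A : Matrix ι ι ℝ) (u : ℝ)
    (hA : A * A = 1 + (Real.exp u - Real.exp (-u)) • A) :
    ∃ k : ℤ, |k| ≤ Fintype.card ι ∧ |A.det| = Real.exp (u * k) := by
  set B : Matrix ι ι ℂ := A.map (algebraMap ℝ ℂ) with hB
  have hBB : B * B = 1 + ((Real.exp u - Real.exp (-u) : ℝ) : ℂ) • B := by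
    rw [hB, ← Matrix.map_mul, hA]
    ext i j
    simp [Matrix.one_apply]
    split_ifs <;> simp
  obtain ⟨k, hk, hp⟩ := multiset_norm (u := u) B.charpoly.roots (by
    intro r hr
    obtain ⟨v, hv, h⟩ := root_of_charpoly hr
    have h1 : (B * B) *ᵥ v = (r * r) • v := by
      rw [← Matrix.mulVec_mulVec, h, Matrix.mulVec_smul, h, smul_smul]
    rw [hBB, Matrix.add_mulVec, Matrix.one_mulVec, Matrix.smul_mulVec, h] at h1
    obtain ⟨i, hi⟩ := Function.ne_iff.1 hv
    have h2 := congrFun h1 i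
    simp only [Pi.add_apply, Pi.smul_apply, smul_eq_mul] at h2
    have hi' : v i ≠ 0 := hi
    have h3 : 1 + ((Real.exp u - Real.exp (-u) : ℝ) : ℂ) * r = r * r := by
      apply mul_right_cancel₀ hi'
      linear_combination h2
    have hee : ((Real.exp u : ℝ) : ℂ) * ((Real.exp (-u) : ℝ) : ℂ) = 1 := by
      rw [← Complex.ofReal_mul, ← Real.exp_add]; simp
    have h4 : (r - (Real.exp u : ℝ)) * (r + (Real.exp (-u) : ℝ)) = 0 := by
      rw [Complex.ofReal_sub] at h3
      linear_combination -h3 - hee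
    rcases mul_eq_zero.1 h4 with h5 | h5
    · left
      rw [sub_eq_zero.1 h5, Complex.norm_real]; simp
    · right
      rw [eq_neg_of_add_eq_zero_left h5, norm_neg, Complex.norm_real]; simp)
  rw [card_roots_charpoly] at hk
  refine ⟨k, hk, ?_⟩
  rw [← hp, ← Matrix.det_eq_prod_roots_charpoly, hB]
  have : (A.map (algebraMap ℝ ℂ)).det = ((A.det : ℝ) : ℂ) := by
    have := (RingHom.map_det (algebraMap ℝ ℂ) A).symm
    simpa using this
  rw [this, Complex.norm_real, Real.norm_eq_abs]

/-- the finite set of possible traces -/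
noncomputable def trSet (h d : ℕ) : Finset ℂ := by
  classical
  exact (((X ^ (h + 1) - X : ℂ[X]).roots.toFinset).sym d).image (fun s => s.1.sum)

lemma trace_mem {ι : Type*} [Fintype ι] [DecidableEq ι] (A : Matrix ι ι ℝ) (h : ℕ) (hh : 1 ≤ h)
    (hA : A ^ (h + 1) = A) : ((A.trace : ℝ) : ℂ) ∈ trSet h (Fintype.card ι) := by
  classical
  set B : Matrix ι ι ℂ := A.map (algebraMap ℝ ℂ) with hB
  have hBB : B ^ (h + 1) = B := by
    rw [hB, ← Matrix.map_pow, hA]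
  have ht : ((A.trace : ℝ) : ℂ) = B.charpoly.roots.sum := by
    rw [← Matrix.trace_eq_sum_roots_charpoly, hB]
    simp [Matrix.trace]
  rw [ht, trSet, Finset.mem_image]
  refine ⟨Sym.mk B.charpoly.roots (card_roots_charpoly B), ?_, rfl⟩
  rw [Finset.mem_sym_iff]
  intro r hr
  have hr' : r ∈ B.charpoly.roots := hr
  obtain ⟨v, hv, h1⟩ := root_of_charpoly hr'
  have h2 := pow_mulVec h1 (h + 1)
  rw [hBB, h1] at h2
  obtain ⟨i, hi⟩ := Function.ne_iff.1 hv
  have h3 := congrFun h2 i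
  simp only [Pi.smul_apply, smul_eq_mul] at h3
  have hi' : v i ≠ 0 := hi
  have h4 := mul_right_cancel₀ hi' h3
  have hne : (X ^ (h + 1) - X : ℂ[X]) ≠ 0 := by
    intro h0
    have := congrArg (fun p => p.coeff 1) h0
    simp only [coeff_sub, coeff_X_pow, coeff_X_one, coeff_zero] at this
    rw [if_neg (by omega)] at this
    norm_num at this
  rw [Multiset.mem_toFinset, mem_roots hne]
  simp [IsRoot, ← h4]

end analytic

end CS8


namespace CS8

section analytic2

open Matrix Polynomial Filter Topology

lemma list_det_norm {κ : Type*} [Fintype κ] [DecidableEq κ] (u : ℝ) (l : List (Matrix κ κ ℝ))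
    (h : ∀ A ∈ l, ∃ k : ℤ, |k| ≤ Fintype.card κ ∧ |A.det| = Real.exp (u * k)) :
    ∃ k : ℤ, |k| ≤ l.length * Fintype.card κ ∧ |l.prod.det| = Real.exp (u * k) := by
  induction l with
  | nil => exact ⟨0, by simp⟩
  | cons A l ih =>
    obtain ⟨k, hk, hp⟩ := ih (fun B hB => h B (List.mem_cons_of_mem _ hB))
    obtain ⟨k', hk', hp'⟩ := h A List.mem_cons_self
    refine ⟨k' + k, ?_, ?_⟩
    · rw [List.length_cons]; push_cast
      have := abs_add_le k' k
      linarith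
    · rw [List.prod_cons, Matrix.det_mul, abs_mul, hp, hp', ← Real.exp_add]
      push_cast; ring_nf

lemma eig_exp {B ι : Type*} [Fintype ι] [DecidableEq ι] (L : B → Matrix ι ι ℝ) (u : ℝ)
    (hL : ∀ i, L i * L i = 1 + (Real.exp u - Real.exp (-u)) • L i) (ω : List B)
    (π : Matrix ι ι ℝ) (hπ : π = (ω.map L).prod) (hcomm : ∀ i, L i * π = π * L i)
    (v : ι → ℝ) (hv : v ≠ 0) (μ : ℝ) (hμ : π *ᵥ v = μ • v) (hμ0 : 0 ≤ μ) :
    ∃ (d : ℕ) (K : ℤ), 1 ≤ d ∧ d ≤ Fintype.card ι ∧ |K| ≤ ω.length * Fintype.card ι ∧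
      μ = Real.exp (u * (K / d)) := by
  classical
  set E : Submodule ℝ (ι → ℝ) := LinearMap.ker (Matrix.toLin' π - μ • LinearMap.id) with hE
  have memE : ∀ x, x ∈ E ↔ π *ᵥ x = μ • x := by
    intro x
    rw [hE, LinearMap.mem_ker]
    simp [sub_eq_zero]
  have hst : ∀ i, ∀ x ∈ E, Matrix.toLin' (L i) x ∈ E := by
    intro i x hx
    rw [memE] at hx ⊢
    rw [Matrix.toLin'_apply, Matrix.mulVec_mulVec, ← hcomm, ← Matrix.mulVec_mulVec, hx,
      Matrix.mulVec_smul]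
  set f : B → (E →ₗ[ℝ] E) := fun i => (Matrix.toLin' (L i)).restrict (hst i) with hf
  set b := Module.finBasis ℝ E with hb
  set d := Module.finrank ℝ E with hd
  have hdpos : 1 ≤ d := by
    have : Nontrivial E := by
      refine ⟨⟨⟨v, (memE v).2 hμ⟩, 0, ?_⟩⟩
      intro h
      exact hv (congrArg Subtype.val h)
    exact Module.finrank_pos
  have hdle : d ≤ Fintype.card ι := by
    have := Submodule.finrank_le E
    rwa [Module.finrank_fintype_fun_eq_card] at this
  have hff : ∀ i, f i * f i = 1 + (Real.exp u - Real.exp (-u)) • f i := by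
    intro i
    ext x : 1
    apply Subtype.ext
    have h1 := congrArg (fun A => A *ᵥ (x : ι → ℝ)) (hL i)
    simp only [← Matrix.mulVec_mulVec, Matrix.add_mulVec, Matrix.one_mulVec,
      Matrix.smul_mulVec] at h1
    exact h1
  have hprod : ∀ (l : List B) (x : E), (((l.map f).prod x : E) : ι → ℝ) = (l.map L).prod *ᵥ (x : ι → ℝ) := by
    intro l
    induction l with
    | nil => intro x; simp
    | cons i l ih =>
      intro x
      rw [List.map_cons, List.prod_cons, List.map_cons, List.prod_cons, ← Matrix.mulVec_mulVec,
        ← ih]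
      rfl
  have hprodω : (ω.map f).prod = μ • (1 : E →ₗ[ℝ] E) := by
    ext x : 1
    apply Subtype.ext
    rw [hprod, ← hπ]
    exact (memE _).1 x.2
  obtain ⟨K, hK, hdet⟩ := list_det_norm u (ω.map (fun i => LinearMap.toMatrixAlgEquiv b (f i))) (by
    intro A hA
    obtain ⟨i, _, rfl⟩ := List.mem_map.1 hA
    apply det_quadratic
    rw [← map_mul, hff, map_add, map_one, map_smul])
  have h1 : (ω.map (fun i => LinearMap.toMatrixAlgEquiv b (f i))).prod =
      μ • (1 : Matrix (Fin d) (Fin d) ℝ) := by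
    have := congrArg (LinearMap.toMatrixAlgEquiv b) hprodω
    rw [map_list_prod, map_smul, map_one, List.map_map] at this
    exact this
  rw [h1, Matrix.det_smul, Matrix.det_one, mul_one, abs_pow, abs_of_nonneg hμ0, Fintype.card_fin]
    at hdet
  refine ⟨d, K, hdpos, hdle, ?_, ?_⟩
  · rw [List.length_map, Fintype.card_fin] at hK
    refine hK.trans ?_
    gcongr
  · have hdne : (d : ℝ) ≠ 0 := by positivity
    have h2 : Real.exp (u * (K / d)) ^ d = μ ^ d := by
      rw [hdet, ← Real.exp_nat_mul]
      congr 1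
      field_simp
    exact (pow_left_inj₀ hμ0 (Real.exp_pos _).le (by omega)).1 h2.symm

lemma aeval_eq_zero {ι : Type*} [Fintype ι] [DecidableEq ι] {π : Matrix ι ι ℝ}
    (hπ : π.IsHermitian) (f : ℝ[X])
    (hf : ∀ (v : ι → ℝ) (μ : ℝ), v ≠ 0 → π *ᵥ v = μ • v → f.eval μ = 0) : aeval π f = 0 := by
  have key : ∀ (v : ι → ℝ) (μ : ℝ) (f : ℝ[X]), π *ᵥ v = μ • v →
      (aeval π f) *ᵥ v = f.eval μ • v := by
    intro v μ f h
    induction f using Polynomial.induction_on' with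
    | add p q hp hq => rw [map_add, Matrix.add_mulVec, hp, hq, eval_add, add_smul]
    | monomial k a =>
      have hk : ∀ k : ℕ, (π ^ k) *ᵥ v = μ ^ k • v := by
        intro k
        induction k with
        | zero => simp
        | succ k ih => rw [pow_succ, ← Matrix.mulVec_mulVec, h, Matrix.mulVec_smul, ih, smul_smul,
            pow_succ, mul_comm]
      rw [aeval_monomial, eval_monomial, ← Algebra.smul_def, Matrix.smul_mulVec, hk, smul_smul]
  have h0 : Matrix.toLin' (aeval π f) = 0 := by
    refine ((hπ.eigenvectorBasis).toBasis.map (WithLp.linearEquiv 2 ℝ (ι → ℝ))).ext ?_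
    intro j
    have hj := hπ.mulVec_eigenvectorBasis j
    rw [Module.Basis.map_apply, Matrix.toLin'_apply]
    simp only [OrthonormalBasis.coe_toBasis, LinearMap.zero_apply]
    change aeval π f *ᵥ (WithLp.ofLp (hπ.eigenvectorBasis j)) = 0
    rw [key _ _ f hj, hf _ _ ?_ hj, zero_smul]
    intro h
    exact (hπ.eigenvectorBasis.orthonormal.ne_zero j) (by
      ext i; simpa using congrFun h i)
  simpa using h0

end analytic2

end CS8


namespace CS8

section analytic3

open Matrix Polynomial Filter Topology

/-- the finite set of possible exponents -/
noncomputable def expSet (d b : ℕ) : Finset ℝ := by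
  classical
  exact ((Finset.Icc 1 d) ×ˢ (Finset.Icc (-(b : ℤ)) b)).image (fun p => (p.2 : ℝ) / (p.1 : ℝ))

lemma mem_expSet {d b : ℕ} {d' : ℕ} {K : ℤ} (h1 : 1 ≤ d') (h2 : d' ≤ d) (h3 : |K| ≤ b) :
    (K : ℝ) / (d' : ℝ) ∈ expSet d b := by
  classical
  rw [expSet, Finset.mem_image]
  refine ⟨(d', K), ?_, rfl⟩
  rw [abs_le] at h3
  simp only [Finset.mem_product, Finset.mem_Icc]
  exact ⟨⟨h1, h2⟩, h3⟩

lemma continuousOn_aeval_prod {ι α : Type*} [Fintype ι] [DecidableEq ι] (π : ℝ → Matrix ι ι ℝ)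
    (U : Set ℝ) (S : Finset α) (f : α → ℝ → ℝ[X])
    (hf : ∀ x ∈ S, ContinuousOn (fun u => aeval (π u) (f x u)) U) :
    ContinuousOn (fun u => aeval (π u) (∏ x ∈ S, f x u)) U := by
  classical
  induction S using Finset.induction_on with
  | empty => simpa using continuousOn_const
  | insert x S hx ih =>
    simp only [Finset.prod_insert hx, map_mul]
    exact (hf x (Finset.mem_insert_self _ _)).mul
      (ih (fun y hy => hf y (Finset.mem_insert_of_mem hy)))

variable {B ι : Type*} [Fintype ι] [DecidableEq ι]

/-- product over a word -/
noncomputable def TT (L : B → ℝ → Matrix ι ι ℝ) (a : ℝ) (ω : List B) : Matrix ι ι ℝ :=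
  (ω.map (fun i => L i a)).prod

lemma TT_nil (L : B → ℝ → Matrix ι ι ℝ) (a : ℝ) : TT L a [] = 1 := by simp [TT]
lemma TT_cons (L : B → ℝ → Matrix ι ι ℝ) (a : ℝ) (i : B) (ω : List B) :
    TT L a (i :: ω) = L i a * TT L a ω := by simp [TT]
lemma TT_append (L : B → ℝ → Matrix ι ι ℝ) (a : ℝ) (ω ω' : List B) :
    TT L a (ω ++ ω') = TT L a ω * TT L a ω' := by simp [TT]
lemma TT_transpose (L : B → ℝ → Matrix ι ι ℝ) (hsymm : ∀ i a, (L i a)ᵀ = L i a) (a : ℝ)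
    (ω : List B) : (TT L a ω)ᵀ = TT L a ω.reverse := by
  induction ω with
  | nil => simp [TT]
  | cons i ω ih => rw [TT_cons, Matrix.transpose_mul, ih, List.reverse_cons, TT_append, hsymm,
      TT_cons, TT_nil, mul_one]
lemma TT_continuous (L : B → ℝ → Matrix ι ι ℝ) (hcont : ∀ i, Continuous (L i)) (ω : List B) :
    Continuous (fun a => TT L a ω) := by
  induction ω with
  | nil => simpa [TT] using continuous_const
  | cons i ω ih => simp only [TT_cons]; exact (hcont i).mul ih

lemma basis_eval (D : Finset ℝ) {u : ℝ} (hu : 0 < u) {ρ σ : ℝ} (hρ : ρ ∈ D) (hσ : σ ∈ D) :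
    (Lagrange.basis D (fun σ => Real.exp (u * σ)) ρ).eval (Real.exp (u * σ)) =
      if ρ = σ then 1 else 0 := by
  have hinj : Function.Injective (fun σ => Real.exp (u * σ)) := by
    intro x y hxy
    have := Real.exp_injective hxy
    exact mul_left_cancel₀ hu.ne' this
  split_ifs with hρσ
  · subst hρσ
    exact Lagrange.eval_basis_self (v := fun σ => Real.exp (u * σ)) hinj.injOn hρ
  · exact Lagrange.eval_basis_of_ne (v := fun σ => Real.exp (u * σ)) hρσ hσ

theorem spectral_form (L : B → ℝ → Matrix ι ι ℝ) (hcont : ∀ i, Continuous (L i))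
    (hsymm : ∀ i a, (L i a)ᵀ = L i a) (hL : ∀ i a, L i a * L i a = 1 + a • L i a)
    (ω γ : List B) (h : ℕ) (hh : 1 ≤ h) (π : ℝ → Matrix ι ι ℝ)
    (hπ : ∀ a, π a = TT L a ω * (TT L a ω)ᵀ) (hcomm : ∀ i a, L i a * π a = π a * L i a)
    (hpow : ∀ a, (TT L a γ) ^ h = π a) :
    ∃ (D : Finset ℝ) (m : ℝ → ℝ), ∀ u : ℝ, 0 < u → ∀ f : ℝ[X],
      (TT L (Real.exp u - Real.exp (-u)) γ *
        aeval (π (Real.exp u - Real.exp (-u))) f).trace =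
      ∑ ρ ∈ D, m ρ * Real.exp (u * (ρ / h)) * f.eval (Real.exp (u * ρ)) := by
  set A : ℝ → ℝ := fun u => Real.exp u - Real.exp (-u) with hA
  have hAc : Continuous A := by rw [hA]; fun_prop
  obtain ⟨D, hD⟩ : ∃ D, D = expSet (Fintype.card ι) ((ω ++ ω.reverse).length * Fintype.card ι) :=
    ⟨_, rfl⟩
  have hherm : ∀ a, (π a).IsHermitian := by
    intro a
    rw [Matrix.IsHermitian, Matrix.conjTranspose_eq_transpose_of_trivial, hπ,
      Matrix.transpose_mul, Matrix.transpose_transpose]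
  have hpsd : ∀ a, (π a).PosSemidef := by
    intro a
    have := Matrix.posSemidef_self_mul_conjTranspose (TT L a ω)
    rwa [Matrix.conjTranspose_eq_transpose_of_trivial, ← hπ] at this
  have hzero : ∀ (u : ℝ) (f : ℝ[X]), (∀ ρ ∈ D, f.eval (Real.exp (u * ρ)) = 0) →
      aeval (π (A u)) f = 0 := by
    intro u f hf
    apply aeval_eq_zero (hherm _)
    intro v μ hv hμ
    have hμ0 : 0 ≤ μ := by
      have h1 := (hpsd (A u)).dotProduct_mulVec_nonneg v
      rw [hμ, dotProduct_smul, smul_eq_mul] at h1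
      have h2 : 0 < star v ⬝ᵥ v := by
        have : 0 ≤ v ⬝ᵥ v := by
          rw [dotProduct]; exact Finset.sum_nonneg fun i _ => mul_self_nonneg _
        have h3 : v ⬝ᵥ v ≠ 0 := fun h0 => hv (dotProduct_self_eq_zero.1 h0)
        simp only [star_trivial]
        exact lt_of_le_of_ne this h3.symm
      exact nonneg_of_mul_nonneg_left h1 h2
    obtain ⟨d, K, h1, h2, h3, rfl⟩ := eig_exp (fun i => L i (A u)) u (fun i => hL i _)
      (ω ++ ω.reverse) (π (A u)) (by
        rw [hπ, TT_transpose L hsymm, ← TT_append]; rfl) (fun i => hcomm i _) v hv μ hμ hμ0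
    exact hf _ (hD ▸ mem_expSet h1 h2 (by exact_mod_cast h3))
  have hagree : ∀ (u : ℝ) (f g : ℝ[X]),
      (∀ ρ ∈ D, f.eval (Real.exp (u * ρ)) = g.eval (Real.exp (u * ρ))) →
      aeval (π (A u)) f = aeval (π (A u)) g := by
    intro u f g hfg
    rw [← sub_eq_zero, ← map_sub]
    apply hzero
    intro ρ hρ
    rw [eval_sub, hfg ρ hρ, sub_self]
  -- idempotents
  set q : ℝ → ℝ → ℝ[X] := fun u ρ => Lagrange.basis D (fun σ => Real.exp (u * σ)) ρ with hq
  have hqe : ∀ u, 0 < u → ∀ ρ ∈ D, ∀ σ ∈ D,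
      (q u ρ).eval (Real.exp (u * σ)) = if ρ = σ then 1 else 0 := fun u hu ρ hρ σ hσ =>
    basis_eval D hu hρ hσ
  set p : ℝ → ℝ → Matrix ι ι ℝ := fun u ρ => aeval (π (A u)) (q u ρ) with hp
  set mm : ℝ → ℝ → ℝ := fun ρ u => Real.exp (-(u * (ρ / h))) * (TT L (A u) γ * p u ρ).trace with hmm
  have hmem : ∀ u, 0 < u → ∀ ρ ∈ D, ((mm ρ u : ℝ) : ℂ) ∈ trSet h (Fintype.card ι) := by
    intro u hu ρ hρ
    have hpp : p u ρ * p u ρ = p u ρ := by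
      rw [hp]; simp only; rw [← map_mul]
      apply hagree
      intro σ hσ
      rw [eval_mul, hqe u hu ρ hρ σ hσ]
      split_ifs <;> simp
    have hπp : π (A u) * p u ρ = Real.exp (u * ρ) • p u ρ := by
      have h1 : aeval (π (A u)) (X * q u ρ) = aeval (π (A u)) (C (Real.exp (u * ρ)) * q u ρ) := by
        apply hagree
        intro σ hσ
        rw [eval_mul, eval_mul, hqe u hu ρ hρ σ hσ]
        split_ifs with hρσ
        · simp [hρσ]
        · simp
      rw [map_mul, map_mul, aeval_X, aeval_C, ← Algebra.smul_def] at h1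
      exact h1
    have hTπ : Commute (TT L (A u) γ) (π (A u)) := by
      rw [← hpow]; exact Commute.self_pow _ _
    have hTp : Commute (TT L (A u) γ) (p u ρ) := by
      have : ∀ f : ℝ[X], Commute (TT L (A u) γ) (aeval (π (A u)) f) := by
        intro f
        induction f using Polynomial.induction_on' with
        | add f g hf hg => rw [map_add]; exact hf.add_right hg
        | monomial k a =>
          rw [aeval_monomial]
          exact (Algebra.commute_algebraMap_right a _).mul_right (hTπ.pow_right k)
      exact this _
    have hpk : ∀ k : ℕ, 1 ≤ k → p u ρ ^ k = p u ρ := by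
      intro k hk
      induction k, hk using Nat.le_induction with
      | base => simp
      | succ k _ ih => rw [pow_succ, ih, hpp]
    have hm : mm ρ u = (Real.exp (-(u * (ρ / h))) • (TT L (A u) γ * p u ρ)).trace := by
      rw [Matrix.trace_smul, smul_eq_mul]
    rw [hm]
    apply trace_mem _ h hh
    have hhr : (h : ℝ) ≠ 0 := by positivity
    have h1 : (Real.exp (-(u * (ρ / h))) • (TT L (A u) γ * p u ρ)) ^ h = p u ρ := by
      rw [_root_.smul_pow, hTp.mul_pow, hpow, hpk h hh, hπp, smul_smul, ← Real.exp_nat_mul,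
        ← Real.exp_add]
      have : (h : ℝ) * -(u * (ρ / h)) + u * ρ = 0 := by field_simp; ring
      rw [this, Real.exp_zero, one_smul]
    rw [pow_succ, h1, Matrix.mul_smul, ← mul_assoc, ← hTp.eq, mul_assoc, hpp]
  have hcts : ∀ ρ ∈ D, ContinuousOn (mm ρ) (Set.Ioi 0) := by
    intro ρ hρ
    rw [hmm]
    apply ContinuousOn.mul
    · fun_prop
    · have h1 : ContinuousOn (fun u => p u ρ) (Set.Ioi 0) := by
        rw [hp, hq]
        simp only [Lagrange.basis]
        apply continuousOn_aeval_prod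
        intro σ hσ
        rw [Finset.mem_erase] at hσ
        simp only [Lagrange.basisDivisor, map_mul, aeval_C, map_sub, aeval_X]
        have hπc : ContinuousOn (fun u => π (A u)) (Set.Ioi 0) := by
          have e : (fun u => π (A u)) = fun u => TT L (A u) γ ^ h := by
            funext u; rw [hpow]
          rw [e]
          exact (((TT_continuous L hcont γ).comp hAc).pow h).continuousOn
        have halg : Continuous (fun r : ℝ => algebraMap ℝ (Matrix ι ι ℝ) r) := by
          simp only [Algebra.algebraMap_eq_smul_one]
          exact continuous_id.smul continuous_const
        apply ContinuousOn.mul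
        · apply halg.comp_continuousOn
          apply ContinuousOn.inv₀
          · fun_prop
          · intro u hu h0
            have := Real.exp_injective (sub_eq_zero.1 h0)
            exact hσ.1 (mul_left_cancel₀ (ne_of_gt hu) this).symm
        · apply hπc.sub
          apply halg.comp_continuousOn
          fun_prop
      have h2 : ContinuousOn (fun u => TT L (A u) γ) (Set.Ioi 0) :=
        ((TT_continuous L hcont γ).comp hAc).continuousOn
      exact (continuous_id.matrix_trace).comp_continuousOn (h2.mul h1)
  have hconst : ∀ ρ ∈ D, ∀ u, 0 < u → mm ρ u = mm ρ 1 := by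
    intro ρ hρ u hu
    have h1 : IsPreconnected (Set.Ioi (0 : ℝ)) := isPreconnected_Ioi
    have h2 : ContinuousOn (fun u => ((mm ρ u : ℝ) : ℂ)) (Set.Ioi 0) :=
      Complex.continuous_ofReal.comp_continuousOn (hcts ρ hρ)
    have h3 := h1.constant_of_mapsTo (T := (trSet h (Fintype.card ι) : Set ℂ))
      (Finset.finite_toSet _).isDiscrete h2
      (fun u hu => hmem u hu ρ hρ) (x := u) (y := 1) hu (Set.mem_Ioi.2 one_pos)
    exact_mod_cast h3
  refine ⟨D, fun ρ => mm ρ 1, ?_⟩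
  intro u hu f
  have h1 : aeval (π (A u)) f = ∑ ρ ∈ D, f.eval (Real.exp (u * ρ)) • p u ρ := by
    have : ∑ ρ ∈ D, f.eval (Real.exp (u * ρ)) • p u ρ =
        aeval (π (A u)) (∑ ρ ∈ D, C (f.eval (Real.exp (u * ρ))) * q u ρ) := by
      rw [map_sum]
      refine Finset.sum_congr rfl fun ρ _ => ?_
      rw [map_mul, aeval_C, ← Algebra.smul_def]
    rw [this]
    apply hagree
    intro σ hσ
    rw [eval_finsetSum, Finset.sum_eq_single σ]
    · rw [eval_mul, hqe u hu σ hσ σ hσ]; simp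
    · intro ρ hρ hne
      rw [eval_mul, hqe u hu ρ hρ σ hσ, if_neg hne, mul_zero]
    · intro h; exact absurd hσ h
  change (TT L (A u) γ * aeval (π (A u)) f).trace = _
  rw [h1, Finset.mul_sum, Matrix.trace_sum]
  refine Finset.sum_congr rfl fun ρ hρ => ?_
  beta_reduce
  rw [← hconst ρ hρ u hu, Matrix.mul_smul, Matrix.trace_smul, smul_eq_mul]
  have : Real.exp (-(u * (ρ / h))) * Real.exp (u * (ρ / h)) = 1 := by
    rw [← Real.exp_add]; simp
  simp only [hmm]
  linear_combination -(f.eval (Real.exp (u * ρ)) * (TT L (A u) γ * p u ρ).trace) * this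

theorem analytic_core (L : B → ℝ → Matrix ι ι ℝ) (hcont : ∀ i, Continuous (L i))
    (hsymm : ∀ i a, (L i a)ᵀ = L i a) (hL : ∀ i a, L i a * L i a = 1 + a • L i a)
    (ω γ : List B) (h n : ℕ) (hh : 1 ≤ h) (π : ℝ → Matrix ι ι ℝ)
    (hπ : ∀ a, π a = TT L a ω * (TT L a ω)ᵀ) (hcomm : ∀ i a, L i a * π a = π a * L i a)
    (hpow : ∀ a, (TT L a γ) ^ h = π a) (htr : ∀ a, (TT L a γ).trace = a ^ n)
    (h0 : π 0 = 1) (z : Matrix ι ι ℝ) (hder : ∀ x y, HasDerivAt (fun a => π a x y) (z x y) 0)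
    (l : ℕ) :
    (TT L 0 γ * z ^ l).trace =
      ∑ i ∈ Finset.range (n + 1), (-1 : ℝ) ^ i * (n.choose i) * ((h : ℝ) / 2 * (n - 2 * i)) ^ l := by
  obtain ⟨D, m, key⟩ := spectral_form L hcont hsymm hL ω γ h hh π hπ hcomm hpow
  set A : ℝ → ℝ := fun u => Real.exp u - Real.exp (-u) with hA
  have hhr : (h : ℝ) ≠ 0 := by positivity
  have hA0 : A 0 = 0 := by simp [hA]
  have hAd : HasDerivAt A 2 0 := by
    have h1 := Real.hasDerivAt_exp 0
    have h2 : HasDerivAt (fun u : ℝ => Real.exp (-u)) (Real.exp (-0) * (-1)) 0 :=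
      (hasDerivAt_neg (0 : ℝ)).exp
    have h3 := h1.sub h2
    norm_num at h3
    exact h3
  -- the exponential sum
  have hexp : ∀ u : ℝ, 0 < u → ∑ ρ ∈ D, m ρ * Real.exp (u * (ρ / h)) =
      ∑ i ∈ Finset.range (n + 1), ((-1 : ℝ) ^ i * (n.choose i)) * Real.exp (u * (n - 2 * i)) := by
    intro u hu
    have h1 := key u hu 1
    simp only [map_one, mul_one, eval_one] at h1
    rw [← h1, htr, sub_eq_add_neg, add_comm, add_pow]
    refine Finset.sum_congr rfl fun i hi => ?_
    have hi' : i ≤ n := by simpa [Nat.lt_succ_iff] using hi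
    rw [neg_pow, ← Real.exp_nat_mul, ← Real.exp_nat_mul]
    have : Real.exp (u * (n - 2 * i)) = Real.exp (i * -u) * Real.exp (((n - i : ℕ) : ℝ) * u) := by
      rw [← Real.exp_add]
      congr 1
      push_cast [hi']
      ring
    rw [this]
    ring
  have hmom := exp_sum_eq D (Finset.range (n + 1)) m (fun ρ => ρ / h)
    (fun i => (-1 : ℝ) ^ i * (n.choose i)) (fun i => n - 2 * i) hexp l
  -- the limit
  have hlim1 : Tendsto (fun u : ℝ => (TT L (A u) γ * ((1 / u) • (π (A u) - 1)) ^ l).trace)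
      (𝓝[>] 0) (𝓝 ((TT L 0 γ * ((2 : ℝ) • z) ^ l).trace)) := by
    have hT : Tendsto (fun u : ℝ => TT L (A u) γ) (𝓝[>] 0) (𝓝 (TT L 0 γ)) := by
      have h1 := ((TT_continuous L hcont γ).comp
        (by rw [hA]; fun_prop : Continuous A)).tendsto 0
      simp only [Function.comp_apply, hA0] at h1
      exact h1.mono_left nhdsWithin_le_nhds
    have hZ : Tendsto (fun u : ℝ => (1 / u) • (π (A u) - 1)) (𝓝[>] 0) (𝓝 ((2 : ℝ) • z)) := by
      refine tendsto_pi_nhds.2 fun x => tendsto_pi_nhds.2 fun y => ?_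
      have h1 : HasDerivAt (fun u => π (A u) x y) (z x y * 2) 0 :=
        HasDerivAt.comp (h₂ := fun a => π a x y) (0 : ℝ) (by rw [hA0]; exact hder x y) hAd
      have h2 := h1.tendsto_slope_zero_right
      simp only [zero_add, hA0, h0] at h2
      have e : ((2 : ℝ) • z) x y = z x y * 2 := by simp [mul_comm]
      rw [e]
      refine h2.congr fun u => ?_
      simp
    have hp : Tendsto (fun u : ℝ => TT L (A u) γ * ((1 / u) • (π (A u) - 1)) ^ l)
      (𝓝[>] 0) (𝓝 (TT L 0 γ * ((2 : ℝ) • z) ^ l)) := hT.mul (hZ.pow l)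
    exact ((continuous_id.matrix_trace).tendsto _).comp hp
  have hlim2 : Tendsto (fun u : ℝ => (TT L (A u) γ * ((1 / u) • (π (A u) - 1)) ^ l).trace)
      (𝓝[>] 0) (𝓝 (∑ ρ ∈ D, m ρ * ρ ^ l)) := by
    have h1 : Tendsto (fun u : ℝ => ∑ ρ ∈ D, m ρ * Real.exp (u * (ρ / h)) *
        ((Real.exp (u * ρ) - 1) / u) ^ l) (𝓝[>] 0) (𝓝 (∑ ρ ∈ D, m ρ * ρ ^ l)) := by
      apply tendsto_finsetSum
      intro ρ _
      have h2 : Tendsto (fun u : ℝ => Real.exp (u * (ρ / h))) (𝓝[>] 0) (𝓝 1) := by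
        have := (by fun_prop : Continuous (fun u : ℝ => Real.exp (u * (ρ / h)))).tendsto 0
        simp only [zero_mul, Real.exp_zero] at this
        exact this.mono_left nhdsWithin_le_nhds
      have h3 : Tendsto (fun u : ℝ => (Real.exp (u * ρ) - 1) / u) (𝓝[>] 0) (𝓝 ρ) := by
        have h4 : HasDerivAt (fun u : ℝ => Real.exp (u * ρ)) ρ 0 := by
          have h5 : HasDerivAt (fun u : ℝ => u * ρ) ρ 0 := by
            simpa using (hasDerivAt_id (0 : ℝ)).mul_const ρ
          simpa using h5.exp
        have h6 := h4.tendsto_slope_zero_right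
        refine h6.congr fun u => ?_
        simp [div_eq_inv_mul]
      simpa using (tendsto_const_nhds.mul h2).mul (h3.pow l)
    refine h1.congr' ?_
    filter_upwards [self_mem_nhdsWithin] with u hu
    have h2 := key u hu ((C (1 / u) * (X - 1)) ^ l)
    rw [map_pow, map_mul, map_sub, map_one, aeval_X, aeval_C, ← Algebra.smul_def] at h2
    refine Eq.trans ?_ h2.symm
    refine Finset.sum_congr rfl fun ρ _ => ?_
    simp [div_eq_inv_mul]
  have hfin := tendsto_nhds_unique hlim1 hlim2
  rw [_root_.smul_pow, Matrix.mul_smul, Matrix.trace_smul, smul_eq_mul] at hfin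
  have h3 : ∑ ρ ∈ D, m ρ * ρ ^ l = (h : ℝ) ^ l * ∑ ρ ∈ D, m ρ * (ρ / h) ^ l := by
    rw [Finset.mul_sum]
    refine Finset.sum_congr rfl fun ρ _ => ?_
    rw [div_pow]; field_simp
  rw [h3, hmom] at hfin
  have h4 : (TT L 0 γ * z ^ l).trace = ((h : ℝ) / 2) ^ l *
      ∑ i ∈ Finset.range (n + 1), (-1 : ℝ) ^ i * (n.choose i) * (n - 2 * i) ^ l := by
    rw [div_pow, div_mul_eq_mul_div, eq_div_iff (by positivity), ← hfin]; ring
  rw [h4, Finset.mul_sum]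
  refine Finset.sum_congr rfl fun i _ => ?_
  rw [mul_pow]; ring

end analytic3

end CS8


namespace CS8

open CoxeterSystem Matrix

section hecke

set_option linter.unusedSectionVars false

variable {n : ℕ} {M : CoxeterMatrix (Fin n)} {W : Type*} [Group W] (cs : CoxeterSystem M W)

lemma left_right_desc (w : W) (i : Fin n) : cs.IsLeftDescent w i ↔ cs.IsRightDescent w⁻¹ i := by
  rw [cs.isRightDescent_inv_iff]

lemma left_mul_of_not {w : W} {i : Fin n} (h : ¬ cs.IsLeftDescent w i) :
    cs.IsLeftDescent (cs.simple i * w) i := by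
  rw [cs.isLeftDescent_iff_not_isLeftDescent_mul]; simpa using h

lemma right_mul_of_not {w : W} {i : Fin n} (h : ¬ cs.IsRightDescent w i) :
    cs.IsRightDescent (w * cs.simple i) i := by
  rw [cs.isRightDescent_iff_not_isRightDescent_mul]; simpa using h

lemma right_simple_of_ne {w : W} {s t : Fin n} (h : cs.simple s * w ≠ w * cs.simple t) :
    cs.IsRightDescent (cs.simple s * w) t ↔ cs.IsRightDescent w t := by
  constructor
  · intro h1
    by_contra h2
    have := crossing cs (pos_rep cs h2) (t := s) (fun h3 => (pos_rep_iff cs).1 h3 h1)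
    apply h
    rw [← this]; simp [mul_assoc]
  · intro h1
    by_contra h2
    have := crossing cs (pos_rep cs h2) (t := s) (fun h3 => by
      rw [cs.simple_mul_simple_cancel_left] at h3
      exact (pos_rep_iff cs).1 h3 h1)
    apply h
    have h4 : cs.simple s * w * cs.simple t = cs.simple s * (cs.simple s * w) := by
      nth_rewrite 2 [← this]
      simp [mul_assoc]
    rw [mul_assoc] at h4
    exact (mul_left_cancel h4).symm

lemma left_simple_of_ne {w : W} {s t : Fin n} (h : cs.simple s * w ≠ w * cs.simple t) :
    cs.IsLeftDescent (w * cs.simple t) s ↔ cs.IsLeftDescent w s := by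
  rw [left_right_desc, left_right_desc, _root_.mul_inv_rev, cs.inv_simple]
  apply right_simple_of_ne
  intro h1
  apply h
  have := congrArg (·⁻¹) h1
  simp at this
  exact this.symm

lemma reduced_cons {i : Fin n} {ω : List (Fin n)} (h : cs.IsReduced (i :: ω)) :
    cs.IsReduced ω ∧ ¬ cs.IsLeftDescent (cs.wordProd ω) i := by
  have h1 : cs.IsReduced ω := by simpa using h.drop 1
  refine ⟨h1, ?_⟩
  rw [cs.not_isLeftDescent_iff, ← cs.wordProd_cons, h.eq, h1.eq, List.length_cons]

lemma reduced_cons_of {i : Fin n} {ω : List (Fin n)} (h : cs.IsReduced ω)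
    (hi : ¬ cs.IsLeftDescent (cs.wordProd ω) i) : cs.IsReduced (i :: ω) := by
  rw [cs.not_isLeftDescent_iff, ← cs.wordProd_cons, h.eq] at hi
  exact hi

variable [Fintype W] [DecidableEq W]

/-- permutation matrix of left multiplication -/
noncomputable def Pm (g : W) : Matrix W W ℝ := fun x w => if x = g * w then 1 else 0

open Classical in
/-- descent diagonal -/
noncomputable def Dm (i : Fin n) : Matrix W W ℝ :=
  Matrix.diagonal (fun w => if cs.IsLeftDescent w i then 1 else 0)

/-- Hecke operators -/
noncomputable def HL (i : Fin n) (a : ℝ) : Matrix W W ℝ := Pm (cs.simple i) + a • Dm cs i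

open Classical in
/-- right Hecke operators -/
noncomputable def HR (t : Fin n) (a : ℝ) : Matrix W W ℝ :=
  Matrix.of (fun x w => if x = w * cs.simple t then (1 : ℝ) else 0) +
    a • Matrix.diagonal (fun w => if cs.IsRightDescent w t then 1 else 0)

/-- basis vectors -/
def ee (w : W) : W → ℝ := Pi.single w 1

lemma Pm_ee (g w : W) : Pm g *ᵥ ee w = ee (g * w) := by
  ext x; simp [Pm, ee, Pi.single_apply]

lemma mat_ext {A B : Matrix W W ℝ} (h : ∀ w, A *ᵥ ee w = B *ᵥ ee w) : A = B :=
  Matrix.ext_of_mulVec_single h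

lemma Pm_mul (g k : W) : Pm g * Pm k = Pm (g * k) := by
  apply mat_ext; intro w
  rw [← Matrix.mulVec_mulVec, Pm_ee, Pm_ee, Pm_ee, mul_assoc]

lemma Pm_one : Pm (1 : W) = 1 := by
  apply mat_ext; intro w; rw [Pm_ee]; simp

lemma Pm_trace (g : W) : (Pm g).trace = if g = 1 then (Fintype.card W : ℝ) else 0 := by
  rw [Matrix.trace]
  simp only [Matrix.diag, Pm]
  by_cases h : g = 1
  · simp [h]
  · simp [h]

open Classical in
lemma Dm_ee (i : Fin n) (w : W) :
    Dm cs i *ᵥ ee w = (if cs.IsLeftDescent w i then (1 : ℝ) else 0) • ee w := by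
  ext x; simp [Dm, ee, Matrix.mulVec_diagonal, Pi.single_apply]
  split_ifs <;> simp_all

open Classical in
lemma HL_ee (i : Fin n) (a : ℝ) (w : W) : HL cs i a *ᵥ ee w =
    ee (cs.simple i * w) + (if cs.IsLeftDescent w i then a else 0) • ee w := by
  rw [HL, Matrix.add_mulVec, Pm_ee, Matrix.smul_mulVec, Dm_ee, smul_smul]
  simp

open Classical in
lemma HR_ee (t : Fin n) (a : ℝ) (w : W) : HR cs t a *ᵥ ee w =
    ee (w * cs.simple t) + (if cs.IsRightDescent w t then a else 0) • ee w := by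
  rw [HR, Matrix.add_mulVec, Matrix.smul_mulVec]
  congr 1
  · ext x; simp [ee, Pi.single_apply, Matrix.mulVec, dotProduct]
  · ext x; simp [ee, Matrix.mulVec_diagonal, Pi.single_apply]

lemma HL_sq (i : Fin n) (a : ℝ) : HL cs i a * HL cs i a = 1 + a • HL cs i a := by
  classical
  apply mat_ext; intro w
  rw [← Matrix.mulVec_mulVec, HL_ee, Matrix.mulVec_add, Matrix.mulVec_smul, HL_ee, HL_ee,
    Matrix.add_mulVec, Matrix.smul_mulVec, HL_ee, Matrix.one_mulVec,
    cs.simple_mul_simple_cancel_left]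
  by_cases h : cs.IsLeftDescent w i
  · rw [if_neg (cs.isLeftDescent_iff_not_isLeftDescent_mul.1 h), if_pos h]
    module
  · rw [if_pos (left_mul_of_not cs h), if_neg h] <;> module

lemma HL_symm (i : Fin n) (a : ℝ) : (HL cs i a)ᵀ = HL cs i a := by
  rw [HL, Matrix.transpose_add, Matrix.transpose_smul, Dm, Matrix.diagonal_transpose]
  congr 1
  ext x w
  simp only [Matrix.transpose_apply, Pm]
  congr 1
  rw [eq_iff_iff]
  constructor
  · rintro rfl; simp
  · rintro rfl; simp

lemma HL_cont (i : Fin n) : Continuous (HL cs i) := by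
  unfold HL
  exact continuous_const.add (continuous_id.smul continuous_const)

lemma HL_zero (i : Fin n) : HL cs i 0 = Pm (cs.simple i) := by simp [HL]

lemma TT_zero (ω : List (Fin n)) : TT (HL cs) 0 ω = Pm (cs.wordProd ω) := by
  induction ω with
  | nil => rw [TT_nil, cs.wordProd_nil, Pm_one]
  | cons i ω ih => rw [TT_cons, ih, HL_zero, Pm_mul, cs.wordProd_cons]

lemma HL_HR (s t : Fin n) (a : ℝ) : HL cs s a * HR cs t a = HR cs t a * HL cs s a := by
  classical
  apply mat_ext; intro w
  rw [← Matrix.mulVec_mulVec, ← Matrix.mulVec_mulVec, HL_ee, HR_ee, Matrix.mulVec_add,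
    Matrix.mulVec_add, Matrix.mulVec_smul, Matrix.mulVec_smul, HL_ee, HL_ee, HR_ee, HR_ee,
    mul_assoc]
  by_cases h : cs.simple s * w = w * cs.simple t
  · have hlr : cs.IsLeftDescent w s ↔ cs.IsRightDescent w t := by
      rw [IsLeftDescent, IsRightDescent, h]
    rw [← h]
    by_cases h1 : cs.IsLeftDescent w s
    · have h2 := hlr.1 h1
      have h3 := (cs.isLeftDescent_iff_not_isLeftDescent_mul.1 h1)
      have h4 := (cs.isRightDescent_iff_not_isRightDescent_mul.1 h2)
      rw [← h] at h4
      rw [if_pos h1, if_pos h2, if_neg h3, if_neg h4]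
    · have h2 := fun h2 => h1 (hlr.2 h2)
      have h3 := (left_mul_of_not cs h1)
      have h4 := (right_mul_of_not cs h2)
      rw [← h] at h4
      rw [if_neg h1, if_neg h2, if_pos h3, if_pos h4]
  · have h1 := left_simple_of_ne cs h
    have h2 := right_simple_of_ne cs h
    simp only [h1, h2]
    module

lemma TT_HR (ω : List (Fin n)) (t : Fin n) (a : ℝ) :
    TT (HL cs) a ω * HR cs t a = HR cs t a * TT (HL cs) a ω := by
  induction ω with
  | nil => simp [TT_nil]
  | cons i ω ih => rw [TT_cons, mul_assoc, ih, ← mul_assoc, HL_HR, mul_assoc]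

lemma eq_of_ee_one (a : ℝ) {A B : Matrix W W ℝ} (hA : ∀ t, A * HR cs t a = HR cs t a * A)
    (hB : ∀ t, B * HR cs t a = HR cs t a * B) (h : A *ᵥ ee 1 = B *ᵥ ee 1) : A = B := by
  classical
  apply mat_ext
  intro w
  induction hd : cs.length w generalizing w with
  | zero => rw [cs.length_eq_zero_iff.1 hd]; exact h
  | succ d ih =>
    have hw1 : w ≠ 1 := by rintro rfl; simp at hd
    obtain ⟨t, ht⟩ := cs.exists_rightDescent_of_ne_one hw1
    have hlen := cs.isRightDescent_iff.1 ht
    have h1 := ih (w * cs.simple t) (by omega)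
    have h2 : ee w = HR cs t a *ᵥ ee (w * cs.simple t) := by
      rw [HR_ee, if_neg (cs.isRightDescent_iff_not_isRightDescent_mul.1 ht)]
      simp
    rw [h2, Matrix.mulVec_mulVec, Matrix.mulVec_mulVec, hA, hB, ← Matrix.mulVec_mulVec, h1,
      Matrix.mulVec_mulVec]

lemma TT_ee_one (a : ℝ) (ω : List (Fin n)) (h : cs.IsReduced ω) :
    TT (HL cs) a ω *ᵥ ee 1 = ee (cs.wordProd ω) := by
  classical
  induction ω with
  | nil => simp [TT_nil]
  | cons i ω ih =>
    obtain ⟨h1, h2⟩ := reduced_cons cs h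
    rw [TT_cons, ← Matrix.mulVec_mulVec, ih h1, HL_ee, if_neg h2, cs.wordProd_cons]
    simp

lemma TT_eq (a : ℝ) {ω ω' : List (Fin n)} (h : cs.IsReduced ω) (h' : cs.IsReduced ω')
    (he : cs.wordProd ω = cs.wordProd ω') : TT (HL cs) a ω = TT (HL cs) a ω' := by
  apply eq_of_ee_one cs a (fun t => TT_HR cs ω t a) (fun t => TT_HR cs ω' t a)
  rw [TT_ee_one cs a ω h, TT_ee_one cs a ω' h', he]

end hecke

end CS8


namespace CS8

open CoxeterSystem Matrix

section bip

set_option linter.unusedSectionVars false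

variable {n : ℕ} {M : CoxeterMatrix (Fin n)} {W : Type*} [Group W] (cs : CoxeterSystem M W)

/-! ### values of the Perron-Frobenius functional -/

/-- coordinates of the moved point -/
noncomputable def vl (η : Fin n → ℝ) (w : W) (i : Fin n) : ℝ := ∑ j, η j * rep cs w⁻¹ (rt i) j

lemma vl_simple (η : Fin n → ℝ) (w : W) (i j : Fin n) :
    vl cs η (cs.simple i * w) j =
      vl cs η w j - ((if i = j then 2 else 0) - cA M i j) * vl cs η w i := by
  unfold vl
  rw [_root_.mul_inv_rev, cs.inv_simple, rep_mul_apply, rep_simple_apply, map_sub, map_smul, cf_rt,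
    Finset.mul_sum, ← Finset.sum_sub_distrib]
  refine Finset.sum_congr rfl fun k _ => ?_
  simp only [Pi.sub_apply, Pi.smul_apply, smul_eq_mul]
  ring

lemma vl_one (η : Fin n → ℝ) (i : Fin n) : vl cs η 1 i = η i := by
  simp [vl, rt, Pi.single_apply]

lemma vl_pos_iff {η : Fin n → ℝ} (hη : ∀ i, 0 < η i) (w : W) (i : Fin n) :
    0 < vl cs η w i ↔ ¬ cs.IsLeftDescent w i := by
  rw [left_right_desc]
  constructor
  · intro h hd
    have h1 := neg_rep cs hd
    have : vl cs η w i ≤ 0 := by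
      unfold vl
      apply Finset.sum_nonpos
      intro j _
      have := h1 j
      simp only [Pi.neg_apply] at this
      exact mul_nonpos_of_nonneg_of_nonpos (hη j).le (by linarith)
    linarith
  · intro hd
    have h1 := pos_rep cs hd
    have h2 := rep_rt_ne_zero cs w⁻¹ i
    obtain ⟨k, hk⟩ := Function.ne_iff.1 h2
    unfold vl
    apply Finset.sum_pos'
    · intro j _; exact mul_nonneg (hη j).le (h1 j)
    · refine ⟨k, Finset.mem_univ _, mul_pos (hη k) (lt_of_le_of_ne (h1 k) ?_)⟩
      exact fun h => hk h.symm

lemma vl_list (η : Fin n → ℝ) (w : W) (l : List (Fin n)) (hl : l.Nodup)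
    (hc : ∀ i ∈ l, ∀ j ∈ l, cA M i j = 0) (j : Fin n) :
    vl cs η (cs.wordProd l * w) j = (if j ∈ l then - vl cs η w j else vl cs η w j) +
      (l.map (fun i => cA M i j * vl cs η w i)).sum := by
  induction l generalizing j with
  | nil => simp
  | cons i l ih =>
    have hi : i ∉ l := (List.nodup_cons.1 hl).1
    have ih' := ih (List.nodup_cons.1 hl).2
      (fun a ha b hb => hc a (List.mem_cons_of_mem _ ha) b (List.mem_cons_of_mem _ hb))
    have hvi : vl cs η (cs.wordProd l * w) i = vl cs η w i := by
      rw [ih', if_neg hi]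
      have : (l.map (fun k => cA M k i * vl cs η w k)) = l.map (fun _ => 0) := by
        apply List.map_congr_left
        intro k hk
        rw [hc k (List.mem_cons_of_mem _ hk) i List.mem_cons_self, zero_mul]
      rw [this]; simp
    rw [cs.wordProd_cons, mul_assoc, vl_simple, hvi, ih', List.map_cons, List.sum_cons]
    by_cases hij : i = j
    · subst hij
      rw [if_neg hi, if_pos List.mem_cons_self, if_pos rfl]
      ring
    · have : (j ∈ i :: l) ↔ j ∈ l := by simp [Ne.symm hij]
      simp only [this]
      rw [if_neg hij]
      ring

lemma reduced_append {η : Fin n → ℝ} (hη : ∀ i, 0 < η i) (ω : List (Fin n))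
    (hω : cs.IsReduced ω) (l : List (Fin n)) (hl : l.Nodup)
    (hc : ∀ i ∈ l, ∀ j ∈ l, cA M i j = 0) (hpos : ∀ i ∈ l, 0 < vl cs η (cs.wordProd ω) i) :
    cs.IsReduced (l ++ ω) := by
  induction l with
  | nil => simpa using hω
  | cons i l ih =>
    have hi : i ∉ l := (List.nodup_cons.1 hl).1
    have h1 := ih (List.nodup_cons.1 hl).2
      (fun a ha b hb => hc a (List.mem_cons_of_mem _ ha) b (List.mem_cons_of_mem _ hb))
      (fun a ha => hpos a (List.mem_cons_of_mem _ ha))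
    rw [List.cons_append]
    apply reduced_cons_of cs h1
    rw [← vl_pos_iff cs hη, cs.wordProd_append, vl_list cs η _ l (List.nodup_cons.1 hl).2
      (fun a ha b hb => hc a (List.mem_cons_of_mem _ ha) b (List.mem_cons_of_mem _ hb)), if_neg hi]
    have : (l.map (fun k => cA M k i * vl cs η (cs.wordProd ω) k)) = l.map (fun _ => 0) := by
      apply List.map_congr_left
      intro k hk
      rw [hc k (List.mem_cons_of_mem _ hk) i List.mem_cons_self, zero_mul]
    rw [this]
    simpa using hpos i List.mem_cons_self

/-! ### alternating words -/

/-- colour classes -/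
def cl (col : Fin n → Bool) (b : Bool) : List (Fin n) :=
  (List.finRange n).filter (fun i => col i = b)

lemma mem_cl {col : Fin n → Bool} {b : Bool} {i : Fin n} : i ∈ cl col b ↔ col i = b := by
  simp [cl]

lemma cl_nodup (col : Fin n → Bool) (b : Bool) : (cl col b).Nodup :=
  (List.nodup_finRange n).filter _

lemma cl_perm (col : Fin n → Bool) (b : Bool) :
    (cl col (!b) ++ cl col b).Perm (List.finRange n) := by
  rw [List.perm_ext_iff_of_nodup _ (List.nodup_finRange n)]
  · intro i
    rw [List.mem_append, mem_cl, mem_cl]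
    cases b <;> cases h : col i <;> simp
  · rw [List.nodup_append]
    refine ⟨cl_nodup _ _, cl_nodup _ _, ?_⟩
    rintro i hi j hj rfl
    rw [mem_cl] at hi hj
    rw [hi] at hj
    cases b <;> simp at hj

/-- leading colour -/
def lead (b : Bool) : ℕ → Bool
  | 0 => b
  | m + 1 => !(lead b m)

/-- alternating words of classes -/
def altw (col : Fin n → Bool) (b : Bool) : ℕ → List (Fin n)
  | 0 => []
  | m + 1 => cl col (lead b m) ++ altw col b m

lemma lead_add (b : Bool) (m k : ℕ) : lead b (m + k) = lead (lead b k) m := by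
  induction m with
  | zero => simp [lead]
  | succ m ih => rw [Nat.succ_add]; simp [lead, ih]

lemma altw_add (col : Fin n → Bool) (b : Bool) (m k : ℕ) :
    altw col b (m + k) = altw col (lead b k) m ++ altw col b k := by
  induction m with
  | zero => simp [altw]
  | succ m ih => rw [Nat.succ_add]; simp only [altw]; rw [ih, lead_add, List.append_assoc]

lemma lead_two (b : Bool) (m : ℕ) : lead b (2 * m) = b := by
  induction m with
  | zero => rfl
  | succ m ih => rw [Nat.mul_succ]; simp [lead, ih]

lemma lead_not (b : Bool) (m : ℕ) : lead (!b) m = !(lead b m) := by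
  induction m with
  | zero => rfl
  | succ m ih => simp [lead, ih]

lemma altw_length (col : Fin n → Bool) (b : Bool) (m : ℕ) :
    (altw col b m).length + (altw col (!b) m).length = m * n := by
  induction m with
  | zero => simp [altw]
  | succ m ih =>
    have := (cl_perm col (lead b m)).length_eq
    rw [List.length_append, List.length_finRange] at this
    simp only [altw, List.length_append, lead_not]
    rw [Nat.succ_mul]
    omega

lemma TT_altw {ι : Type*} [Fintype ι] [DecidableEq ι] (L : Fin n → ℝ → Matrix ι ι ℝ) (a : ℝ)
    (col : Fin n → Bool) (b : Bool) (m : ℕ) :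
    TT L a (altw col b (2 * m)) = TT L a (cl col (!b) ++ cl col b) ^ m := by
  induction m with
  | zero => simp [altw, TT_nil]
  | succ m ih =>
    rw [Nat.mul_succ, add_comm, altw_add, lead_two, TT_append, ih, pow_succ']
    simp [altw, lead]

/-- the scalar recursion -/
noncomputable def EE (τ : ℝ) : ℕ → ℝ
  | 0 => -1
  | 1 => 1
  | (m + 2) => τ * EE τ (m + 1) - EE τ m

lemma altw_step {η : Fin n → ℝ} {τ : ℝ} (hη : ∀ i, 0 < η i)
    (hpf : ∀ i, ∑ j, cA M i j * η j = τ * η i) {col : Fin n → Bool}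
    (hcol : ∀ i j, cA M i j ≠ 0 → col i ≠ col j) (b : Bool) (m : ℕ)
    (hE : ∀ k < m, 0 < EE τ (k + 1)) :
    cs.IsReduced (altw col b m) ∧
    (∀ i, vl cs η (cs.wordProd (altw col b m)) i =
      if col i = lead b m then EE τ (m + 1) * η i else - EE τ m * η i) := by
  have hcl : ∀ b, ∀ i ∈ cl col b, ∀ j ∈ cl col b, cA M i j = 0 := by
    intro b i hi j hj
    by_contra h
    rw [mem_cl] at hi hj
    exact hcol i j h (hi.trans hj.symm)
  induction m with
  | zero =>
    refine ⟨by simp [altw, CoxeterSystem.IsReduced], fun i => ?_⟩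
    simp [altw, vl_one, EE]
  | succ m ih =>
    obtain ⟨h1, h2⟩ := ih (fun k hk => hE k (by omega))
    have hpos := hE m (by omega)
    refine ⟨?_, ?_⟩
    · refine reduced_append cs hη _ h1 _ (cl_nodup _ _) (hcl _) ?_
      intro i hi
      rw [h2, if_pos (mem_cl.1 hi)]
      exact mul_pos hpos (hη i)
    · intro i
      simp only [altw]
      rw [cs.wordProd_append, vl_list cs η _ _ (cl_nodup _ _) (hcl _)]
      have hsum : ((cl col (lead b m)).map
          (fun j => cA M j i * vl cs η (cs.wordProd (altw col b m)) j)).sum =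
          if col i = lead b m then 0 else EE τ (m + 1) * (τ * η i) := by
        rw [← List.sum_toFinset _ (cl_nodup _ _)]
        split_ifs with hi
        · apply Finset.sum_eq_zero
          intro j hj
          rw [List.mem_toFinset] at hj
          rw [hcl _ j hj i (mem_cl.2 hi), zero_mul]
        · rw [← hpf i, Finset.mul_sum]
          rw [← Finset.sum_subset (Finset.subset_univ (cl col (lead b m)).toFinset)]
          · refine Finset.sum_congr rfl fun j hj => ?_
            rw [List.mem_toFinset, mem_cl] at hj
            rw [h2, if_pos hj, cA_symm]; ring
          · intro j _ hj
            rw [List.mem_toFinset, mem_cl] at hj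
            have : cA M i j = 0 := by
              by_contra h
              apply hcol i j h
              revert hi hj
              cases col i <;> cases col j <;> cases lead b m <;> simp
            rw [this]; ring
      rw [hsum]
      rw [h2 i]
      have hlead : lead b (m + 1) = !(lead b m) := rfl
      by_cases hi : col i = lead b m
      · rw [if_pos (mem_cl.2 hi), if_pos hi, if_pos hi, if_neg (show ¬ col i = lead b (m + 1) by
          rw [hlead, hi]; simp)]
        ring
      · rw [if_neg (fun h => hi (mem_cl.1 h)), if_neg hi, if_neg hi,
          if_pos (show col i = lead b (m + 1) by
            rw [hlead]; revert hi; cases col i <;> cases lead b m <;> simp)]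
        rw [EE]; ring

theorem exists_bip [Finite W] (hn : 1 ≤ n) {η : Fin n → ℝ} {τ : ℝ} (hη : ∀ i, 0 < η i)
    (hpf : ∀ i, ∑ j, cA M i j * η j = τ * η i) {col : Fin n → Bool}
    (hcol : ∀ i j, cA M i j ≠ 0 → col i ≠ col j) {w0 : W}
    (hw0 : ∀ i, cs.IsRightDescent w0 i ∧ cs.IsLeftDescent w0 i) :
    ∃ k : ℕ, 1 ≤ k ∧ ∀ b, cs.IsReduced (altw col b k) ∧ cs.wordProd (altw col b k) = w0 := by
  have hex : ∃ m, EE τ (m + 1) ≤ 0 := by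
    by_contra hcon
    push Not at hcon
    have h1 := (altw_step cs hη hpf hcol true (2 * (cs.length w0 + 1)) (fun k _ => hcon k)).1
    have h2 := (altw_step cs hη hpf hcol false (2 * (cs.length w0 + 1)) (fun k _ => hcon k)).1
    have h3 := altw_length col true (2 * (cs.length w0 + 1))
    have h4 := length_longest cs hw0 (cs.wordProd (altw col true (2 * (cs.length w0 + 1))))
    have h5 := length_longest cs hw0 (cs.wordProd (altw col false (2 * (cs.length w0 + 1))))
    rw [h1.eq] at h4
    rw [h2.eq] at h5
    simp only [Bool.not_true] at h3
    have : 2 * (cs.length w0 + 1) * 1 ≤ 2 * (cs.length w0 + 1) * n := Nat.mul_le_mul_left _ hn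
    omega
  classical
  set k := Nat.find hex with hk
  have hk1 : EE τ (k + 1) ≤ 0 := Nat.find_spec hex
  have hk2 : ∀ m < k, 0 < EE τ (m + 1) := fun m hm => not_le.1 (Nat.find_min hex hm)
  have hkpos : 1 ≤ k := by
    by_contra h
    have : k = 0 := by omega
    rw [this] at hk1
    simp [EE] at hk1
    linarith
  refine ⟨k, hkpos, fun b => ?_⟩
  obtain ⟨h1, h2⟩ := altw_step cs hη hpf hcol b k hk2
  refine ⟨h1, ?_⟩
  apply longest_unique_right cs (fun i => (hw0 i).1)
  intro i
  by_contra hi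
  rw [← vl_pos_iff cs hη, h2] at hi
  have hEk : 0 < EE τ k := by
    have := hk2 (k - 1) (by omega)
    rwa [Nat.sub_add_cancel hkpos] at this
  split_ifs at hi
  · have := mul_nonpos_of_nonpos_of_nonneg hk1 (hη i).le
    linarith
  · have := mul_pos hEk (hη i)
    linarith

end bip

end CS8


namespace CS8

open CoxeterSystem Matrix

section fin

set_option linter.unusedSectionVars false

variable {n : ℕ} {M : CoxeterMatrix (Fin n)} {W : Type*} [Group W] (cs : CoxeterSystem M W)

lemma longest_inv {w0 : W} (h0 : ∀ i, cs.IsRightDescent w0 i ∧ cs.IsLeftDescent w0 i) :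
    w0⁻¹ = w0 :=
  longest_unique_right cs (fun i => (h0 i).1) (fun i => (cs.isLeftDescent_inv_iff).2 (h0 i).1)

lemma length_longest' [Finite W] {w0 : W}
    (h0 : ∀ i, cs.IsRightDescent w0 i ∧ cs.IsLeftDescent w0 i)
    (w : W) : cs.length (w0 * w) + cs.length w = cs.length w0 := by
  rw [← length_longest cs h0 w, ← cs.length_inv (w0 * w), _root_.mul_inv_rev, longest_inv cs h0]

/-! ### left inversion sequences -/

lemma mem_lis {i : Fin n} {ω : List (Fin n)} {t : W} :
    t ∈ cs.leftInvSeq (i :: ω) ↔ t = cs.simple i ∨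
      cs.simple i * t * cs.simple i ∈ cs.leftInvSeq ω := by
  simp only [leftInvSeq, List.mem_cons, List.mem_map, MulAut.conj_apply, cs.inv_simple]
  refine or_congr Iff.rfl ⟨?_, fun h => ⟨_, h, by simp [mul_assoc]⟩⟩
  rintro ⟨u, hu, rfl⟩
  simpa [mul_assoc] using hu

lemma mem_lis_of (ω : List (Fin n)) (g : W) (j : Fin n) (h1 : Pos (rep cs g (rt j)))
    (h2 : Pos (-rep cs ((cs.wordProd ω)⁻¹ * g) (rt j))) :
    g * cs.simple j * g⁻¹ ∈ cs.leftInvSeq ω := by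
  induction ω generalizing g with
  | nil =>
    exfalso
    simp only [wordProd_nil, inv_one, one_mul] at h2
    exact rep_rt_ne_zero cs g j (pos_antisymm h1 h2)
  | cons i ω ih =>
    rw [mem_lis]
    by_cases h3 : Pos (rep cs (cs.simple i * g) (rt j))
    · right
      have := ih (cs.simple i * g) h3 (by
        rw [cs.wordProd_cons, _root_.mul_inv_rev, cs.inv_simple, mul_assoc] at h2
        exact h2)
      simpa [mul_assoc] using this
    · left
      exact crossing cs h1 h3

lemma mem_lis_longest [Finite W] {w0 : W} (h0 : ∀ i, cs.IsRightDescent w0 i ∧ cs.IsLeftDescent w0 i)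
    {ω : List (Fin n)} (hω : cs.wordProd ω = w0) (t : W) :
    t ∈ cs.leftInvSeq ω ↔ cs.IsReflection t := by
  refine ⟨cs.isReflection_of_mem_leftInvSeq ω, ?_⟩
  have hneg : ∀ (g : W) (j : Fin n), Pos (rep cs g (rt j)) →
      g * cs.simple j * g⁻¹ ∈ cs.leftInvSeq ω := by
    intro g j hg
    apply mem_lis_of cs ω g j hg
    rw [hω, longest_inv cs h0, neg_rep_iff cs]
    have h1 := (pos_rep_iff cs).1 hg
    rw [cs.not_isRightDescent_iff] at h1
    have h2 := length_longest' cs h0 g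
    have h3 := length_longest' cs h0 (g * cs.simple j)
    rw [cs.isRightDescent_iff, mul_assoc]
    omega
  rintro ⟨g, j, rfl⟩
  by_cases hg : Pos (rep cs g (rt j))
  · exact hneg g j hg
  · have h1 : cs.IsRightDescent g j := by
      by_contra h; exact hg (pos_rep cs h)
    have h2 : ¬ cs.IsRightDescent (g * cs.simple j) j :=
      (cs.isRightDescent_iff_not_isRightDescent_mul).1 h1
    have := hneg (g * cs.simple j) j (pos_rep cs h2)
    simpa [mul_assoc] using this

variable [Fintype W] [DecidableEq W]

/-! ### entries, trace -/

open Classical in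
lemma HL_mul_apply (i : Fin n) (a : ℝ) (A : Matrix W W ℝ) (x w : W) :
    (HL cs i a * A) x w = A (cs.simple i * x) w +
      a * ((if cs.IsLeftDescent x i then 1 else 0) * A x w) := by
  have h1 : (Pm (cs.simple i) * A) x w = A (cs.simple i * x) w := by
    rw [Matrix.mul_apply, Finset.sum_eq_single (cs.simple i * x)]
    · simp [Pm]
    · intro y _ hy
      have : x ≠ cs.simple i * y := by
        rintro rfl; apply hy; simp
      simp [Pm, this]
    · simp
  rw [HL, add_mul, Matrix.add_apply, h1, Matrix.smul_mul, Matrix.smul_apply, Dm,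
    Matrix.diagonal_mul, smul_eq_mul]

lemma TT_support (a : ℝ) (i : Fin n) (ω : List (Fin n)) (hi : i ∉ ω) (x w : W)
    (h : TT (HL cs) a ω x w ≠ 0) (v : Fin n → ℝ) : rep cs x v i = rep cs w v i := by
  induction ω generalizing x with
  | nil =>
    rw [TT_nil, Matrix.one_apply] at h
    have : x = w := by by_contra h'; simp [h'] at h
    rw [this]
  | cons j ω ih =>
    have hij : i ≠ j := fun h => hi (by simp [h])
    have ih' := ih (fun h => hi (List.mem_cons_of_mem _ h))
    rw [TT_cons, HL_mul_apply] at h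
    by_cases h1 : TT (HL cs) a ω x w = 0
    · rw [h1] at h
      have := ih' (cs.simple j * x) (by simpa using h)
      rw [← this, rep_mul_apply, rep_simple_apply]
      simp [rt, hij]
    · exact ih' x h1

open Classical in
lemma TT_diag (a : ℝ) (ω : List (Fin n)) (hω : ω.Nodup) (w : W) :
    TT (HL cs) a ω w w = (ω.map (fun i => if cs.IsLeftDescent w i then a else 0)).prod := by
  induction ω with
  | nil => simp [TT_nil]
  | cons i ω ih =>
    obtain ⟨h1, h2⟩ := List.nodup_cons.1 hω
    rw [TT_cons, HL_mul_apply, ih h2, List.map_cons, List.prod_cons]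
    have : TT (HL cs) a ω (cs.simple i * w) w = 0 := by
      by_contra h
      have := TT_support cs a i ω h1 _ _ h (rep cs w⁻¹ (rt i))
      rw [rep_mul_apply, rep_inv_apply, rep_simple_apply, cf_rt_self] at this
      simp [rt] at this
    rw [this]
    split_ifs <;> ring

open Classical in
lemma TT_trace (a : ℝ) {w0 : W} (h0 : ∀ i, cs.IsRightDescent w0 i ∧ cs.IsLeftDescent w0 i)
    (γ : List (Fin n)) (hγ : γ.Perm (List.finRange n)) :
    (TT (HL cs) a γ).trace = a ^ n := by
  have hnd : γ.Nodup := hγ.nodup_iff.2 (List.nodup_finRange n)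
  rw [Matrix.trace, Finset.sum_eq_single w0]
  · rw [Matrix.diag_apply, TT_diag cs a γ hnd]
    have : γ.map (fun i => if cs.IsLeftDescent w0 i then a else 0) = γ.map (fun _ => a) :=
      List.map_congr_left (fun i _ => if_pos (h0 i).2)
    rw [this, List.map_const', List.prod_replicate, hγ.length_eq, List.length_finRange]
  · intro w _ hw
    rw [Matrix.diag_apply, TT_diag cs a γ hnd]
    have : ∃ i, ¬ cs.IsLeftDescent w i := by
      by_contra hcon
      push Not at hcon
      exact hw (longest_unique_right cs (fun i => (h0 i).1) hcon)
    obtain ⟨i, hi⟩ := this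
    apply List.prod_eq_zero
    rw [List.mem_map]
    exact ⟨i, hγ.mem_iff.2 (List.mem_finRange i), if_neg hi⟩
  · simp

/-! ### derivative -/

/-- entrywise derivative at zero -/
def HD (F : ℝ → Matrix W W ℝ) (F' : Matrix W W ℝ) : Prop :=
  ∀ x y, HasDerivAt (fun a => F a x y) (F' x y) 0

lemma HD.mul {F G : ℝ → Matrix W W ℝ} {F' G' : Matrix W W ℝ} (hF : HD F F') (hG : HD G G') :
    HD (fun a => F a * G a) (F' * G 0 + F 0 * G') := by
  intro x y
  simp only [Matrix.mul_apply, Matrix.add_apply]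
  rw [← Finset.sum_add_distrib]
  exact HasDerivAt.fun_sum (fun k _ => (hF x k).mul (hG k y))

lemma HL_HD (i : Fin n) : HD (HL cs i) (Dm cs i) := by
  intro x y
  simp only [HL, Matrix.add_apply, Matrix.smul_apply, smul_eq_mul]
  simpa using ((hasDerivAt_id (0 : ℝ)).mul_const (Dm cs i x y)).const_add (Pm (cs.simple i) x y)

lemma Dm_Pm (i : Fin n) : Dm cs i * Pm (cs.simple i) + Pm (cs.simple i) * Dm cs i =
    Pm (cs.simple i) := by
  apply mat_ext
  intro w
  rw [Matrix.add_mulVec, ← Matrix.mulVec_mulVec, ← Matrix.mulVec_mulVec, Pm_ee, Dm_ee, Dm_ee,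
    Matrix.mulVec_smul, Pm_ee, ← add_smul]
  by_cases h : cs.IsLeftDescent w i
  · have h2 := (cs.isLeftDescent_iff_not_isLeftDescent_mul).1 h
    simp [h, h2]
  · have h2 := left_mul_of_not cs h
    simp [h, h2]

lemma TT_sq_HD (ω : List (Fin n)) :
    TT (HL cs) 0 ω * (TT (HL cs) 0 ω)ᵀ = 1 ∧
    HD (fun a => TT (HL cs) a ω * (TT (HL cs) a ω)ᵀ) ((cs.leftInvSeq ω).map Pm).sum := by
  induction ω with
  | nil =>
    refine ⟨by simp [TT_nil], ?_⟩
    intro x y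
    simpa [TT_nil] using hasDerivAt_const (0 : ℝ) ((1 : Matrix W W ℝ) x y)
  | cons i ω ih =>
    have e : ∀ a, TT (HL cs) a (i :: ω) * (TT (HL cs) a (i :: ω))ᵀ =
        HL cs i a * (TT (HL cs) a ω * (TT (HL cs) a ω)ᵀ) * HL cs i a := by
      intro a
      rw [TT_cons, Matrix.transpose_mul, HL_symm]
      simp only [Matrix.mul_assoc]
    simp only [e]
    refine ⟨?_, ?_⟩
    · rw [ih.1, HL_zero, mul_one, Pm_mul, cs.simple_mul_simple_self, Pm_one]
    · have := ((HL_HD cs i).mul ih.2).mul (HL_HD cs i)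
      convert this using 1
      rw [ih.1, HL_zero, mul_one, mul_one]
      simp only [leftInvSeq, List.map_cons, List.sum_cons, List.map_map]
      rw [add_mul, add_right_comm, Dm_Pm]
      congr 1
      generalize cs.leftInvSeq ω = l
      induction l with
      | nil => simp
      | cons t l ihl =>
        simp only [List.map_cons, List.sum_cons, mul_add, add_mul, Function.comp_apply,
          MulAut.conj_apply, cs.inv_simple, Pm_mul]
        rw [ihl]

lemma exists_X {w0 : W} (h0 : ∀ i, cs.IsRightDescent w0 i ∧ cs.IsLeftDescent w0 i)
    {ω : List (Fin n)} (hr : cs.IsReduced ω) (hω : cs.wordProd ω = w0) (a : ℝ) :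
    (TT (HL cs) a ω)ᵀ = TT (HL cs) a ω := by
  rw [TT_transpose _ (HL_symm cs)]
  apply TT_eq cs a hr.reverse hr
  rw [cs.wordProd_reverse, hω, longest_inv cs h0]

lemma X_swap {w0 : W} (h0 : ∀ i, cs.IsRightDescent w0 i ∧ cs.IsLeftDescent w0 i)
    {ω : List (Fin n)} (hr : cs.IsReduced ω) (hω : cs.wordProd ω = w0) (a : ℝ) (i : Fin n) :
    HL cs i a * (TT (HL cs) a ω * (TT (HL cs) a ω)ᵀ) =
      (TT (HL cs) a ω * (TT (HL cs) a ω)ᵀ) * HL cs i a := by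
  obtain ⟨j, hj⟩ := longest_conj cs h0 i
  obtain ⟨ω', hr', hω'⟩ := cs.exists_isReduced (cs.simple i * w0)
  have hl : cs.length (cs.simple i * w0) + 1 = cs.length w0 := cs.isLeftDescent_iff.1 (h0 i).2
  have hl' : ω'.length + 1 = cs.length w0 := by
    rw [← hl, hω', hr'.eq]
  have p1 : cs.wordProd (i :: ω') = w0 := by
    rw [cs.wordProd_cons, ← hω']; simp
  have p2 : cs.wordProd (ω' ++ [j]) = w0 := by
    rw [cs.wordProd_append, ← hω', hj]; simp
  have r1 : cs.IsReduced (i :: ω') := by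
    rw [CoxeterSystem.IsReduced, p1, ← hl']; rfl
  have r2 : cs.IsReduced (ω' ++ [j]) := by
    rw [CoxeterSystem.IsReduced, p2, ← hl']; simp
  have e1 := TT_eq cs a hr r1 (hω.trans p1.symm)
  have e2 := TT_eq cs a hr r2 (hω.trans p2.symm)
  rw [exists_X cs h0 hr hω]
  have e3 : HL cs i a * TT (HL cs) a ω = TT (HL cs) a ω * HL cs j a := by
    nth_rewrite 1 [e2]
    rw [e1, TT_append, TT_cons, TT_cons, TT_nil]
    simp [Matrix.mul_assoc]
  have e4 : TT (HL cs) a ω * HL cs i a = HL cs j a * TT (HL cs) a ω := by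
    have := congrArg Matrix.transpose e3
    simpa only [Matrix.transpose_mul, HL_symm, exists_X cs h0 hr hω] using this
  rw [← Matrix.mul_assoc, e3, Matrix.mul_assoc, Matrix.mul_assoc, e4]

lemma X_pow {w0 : W} (h0 : ∀ i, cs.IsRightDescent w0 i ∧ cs.IsLeftDescent w0 i)
    {col : Fin n → Bool} {k : ℕ}
    (hk : ∀ b, cs.IsReduced (altw col b k) ∧ cs.wordProd (altw col b k) = w0) (a : ℝ) (b : Bool) :
    TT (HL cs) a (cl col (!b) ++ cl col b) ^ k =
      TT (HL cs) a (altw col b k) * (TT (HL cs) a (altw col b k))ᵀ := by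
  rw [exists_X cs h0 (hk b).1 (hk b).2, ← TT_altw, two_mul, altw_add, TT_append]
  congr 1
  exact TT_eq cs a (hk _).1 (hk _).1 ((hk _).2.trans (hk _).2.symm)

end fin

end CS8


namespace CS8

open CoxeterSystem Matrix

section final

set_option linter.unusedSectionVars false

variable {n : ℕ} {M : CoxeterMatrix (Fin n)} {W : Type*} [Group W] (cs : CoxeterSystem M W)
variable [Fintype W] [DecidableEq W]

open Classical in
/-- indicator of reflections -/
noncomputable def chi (r : W) : ℝ := if cs.IsReflection r then 1 else 0

/-- sum of reflections -/
noncomputable def zz : Matrix W W ℝ := ∑ r, chi cs r • Pm r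

lemma zz_eq {w0 : W} (h0 : ∀ i, cs.IsRightDescent w0 i ∧ cs.IsLeftDescent w0 i)
    {ω : List (Fin n)} (hr : cs.IsReduced ω) (hω : cs.wordProd ω = w0) :
    ((cs.leftInvSeq ω).map Pm).sum = zz cs := by
  classical
  rw [← List.sum_toFinset _ hr.nodup_leftInvSeq, zz]
  rw [← Finset.sum_subset (Finset.subset_univ (cs.leftInvSeq ω).toFinset)]
  · refine Finset.sum_congr rfl fun r hr => ?_
    rw [List.mem_toFinset, mem_lis_longest cs h0 hω] at hr
    simp [chi, hr]
  · intro r _ hr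
    rw [List.mem_toFinset, mem_lis_longest cs h0 hω] at hr
    simp [chi, hr]

lemma card_refl {w0 : W} (h0 : ∀ i, cs.IsRightDescent w0 i ∧ cs.IsLeftDescent w0 i)
    {ω : List (Fin n)} (hr : cs.IsReduced ω) (hω : cs.wordProd ω = w0) :
    Nat.card {w : W // cs.IsReflection w} = ω.length := by
  classical
  rw [← cs.length_leftInvSeq ω, ← List.toFinset_card_of_nodup hr.nodup_leftInvSeq]
  rw [Nat.card_eq_fintype_card, Fintype.card_subtype]
  congr 1
  ext t
  rw [List.mem_toFinset, mem_lis_longest cs h0 hω]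
  simp

lemma chi_conj (g r : W) : chi cs (g * r * g⁻¹) = chi cs r := by
  have h := cs.isReflection_conj_iff g r
  by_cases h1 : cs.IsReflection r
  · simp only [chi, if_pos h1, if_pos (h.2 h1)]
  · simp only [chi, if_neg h1, if_neg (fun h2 => h1 (h.1 h2))]

lemma zz_comm (g : W) : Pm g * zz cs = zz cs * Pm g := by
  simp only [zz, Finset.mul_sum, Finset.sum_mul, Matrix.mul_smul, Matrix.smul_mul, Pm_mul]
  refine Fintype.sum_equiv (MulAut.conj g).toEquiv _ _ fun r => ?_
  simp [chi_conj]

lemma zz_pow (l : ℕ) :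
    zz cs ^ l = ∑ f : Fin l → W, (∏ k, chi cs (f k)) • Pm (List.ofFn f).prod := by
  induction l with
  | zero => simp [Pm_one]
  | succ l ih =>
    rw [pow_succ', ih, zz, Finset.sum_mul_sum,
      ← (Fin.consEquiv (fun _ : Fin (l + 1) => W)).sum_comp, Fintype.sum_prod_type]
    refine Finset.sum_congr rfl fun r _ => Finset.sum_congr rfl fun f _ => ?_
    simp [Fin.consEquiv, Fin.prod_univ_succ, List.ofFn_succ, Pm_mul, smul_smul, mul_comm]

lemma trace_count (c : W) (l : ℕ) :
    (Pm c⁻¹ * zz cs ^ l).trace = (Nat.card W : ℝ) * (Nat.card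
      {f : Fin l → W // (∀ k, cs.IsReflection (f k)) ∧ (List.ofFn f).prod = c} : ℝ) := by
  classical
  rw [zz_pow, Finset.mul_sum, Matrix.trace_sum, Nat.card_eq_fintype_card, Nat.card_eq_fintype_card,
    Fintype.card_subtype, Finset.card_filter, Nat.cast_sum, Finset.mul_sum]
  refine Finset.sum_congr rfl fun f _ => ?_
  rw [Matrix.mul_smul, Matrix.trace_smul, Pm_mul, Pm_trace]
  have h3 : c⁻¹ * (List.ofFn f).prod = 1 ↔ (List.ofFn f).prod = c := by
    rw [inv_mul_eq_one, eq_comm]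
  have : ∏ k, chi cs (f k) = if ∀ k, cs.IsReflection (f k) then 1 else 0 := by
    split_ifs with h
    · exact Finset.prod_eq_one fun k _ => if_pos (h k)
    · push Not at h
      obtain ⟨k, hk⟩ := h
      exact Finset.prod_eq_zero (Finset.mem_univ k) (if_neg hk)
  rw [this]
  by_cases h1 : ∀ k, cs.IsReflection (f k) <;> by_cases h2 : (List.ofFn f).prod = c <;>
    simp [h1, h2, h3]

lemma trace_conj {g h : W} (hc : IsConj g h) (l : ℕ) :
    (Pm g * zz cs ^ l).trace = (Pm h * zz cs ^ l).trace := by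
  obtain ⟨u, hu⟩ := isConj_iff.1 hc
  have hz : Commute (Pm u⁻¹) (zz cs ^ l) := Commute.pow_right (zz_comm cs u⁻¹) l
  rw [← hu, ← Pm_mul, ← Pm_mul, Matrix.mul_assoc, hz.eq, ← Matrix.mul_assoc,
    Matrix.trace_mul_comm _ (Pm u⁻¹), ← Matrix.mul_assoc, ← Matrix.mul_assoc, Pm_mul]
  simp [Pm_one]

end final

end CS8

theorem stmt_8 {W : Type*} [Group W] [Finite W] (n : ℕ) (hn : 1 ≤ n)
    (M : CoxeterMatrix (Fin n)) (cs : CoxeterSystem M W)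
    (hirr : ¬ ∃ P : Set (Fin n), P.Nonempty ∧ Pᶜ.Nonempty ∧
      ∀ i ∈ P, ∀ j ∈ Pᶜ, Commute (cs.simple i) (cs.simple j))
    (σ : Equiv.Perm (Fin n)) (c : W) (hc : c = (List.ofFn fun k => cs.simple (σ k)).prod)
    (N : ℕ → ℕ)
    (hN : ∀ l : ℕ, N l = Nat.card
      {f : Fin l → W // (∀ k, cs.IsReflection (f k)) ∧ (List.ofFn f).prod = c})
    (nR : ℕ) (hnR : nR = Nat.card {w : W // cs.IsReflection w}) :
    ∀ l : ℕ, (Nat.card W : ℝ) * N l =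
      ∑ i ∈ Finset.range (n + 1),
        (-1 : ℝ) ^ i * (n.choose i) * ((nR : ℝ) * ((n : ℝ) - 2 * i) / n) ^ l := by
  classical
  intro l
  have : Fintype W := Fintype.ofFinite W
  obtain ⟨w0, h0⟩ := CS8.exists_longest cs
  obtain ⟨η, τ, hη, hpf⟩ := CS8.exists_eta cs hn hirr
  have hleaf := CS8.exists_leaf hη hpf (CS8.tau_lt_two cs hn hη hpf)
  obtain ⟨col, hcol⟩ := CS8.exists_coloring hleaf
  obtain ⟨k, hk1, hk⟩ := CS8.exists_bip cs hn hη hpf hcol h0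
  set γ := CS8.cl col (!true) ++ CS8.cl col true with hγ
  have hperm : γ.Perm (List.finRange n) := CS8.cl_perm col true
  set ω := CS8.altw col true k with hω
  have hωr : cs.IsReduced ω := (hk true).1
  have hωw : cs.wordProd ω = w0 := (hk true).2
  have hder := (CS8.TT_sq_HD cs ω).2
  rw [CS8.zz_eq cs h0 hωr hωw] at hder
  have hmain := CS8.analytic_core (CS8.HL cs) (CS8.HL_cont cs) (CS8.HL_symm cs) (CS8.HL_sq cs)
    ω γ k n hk1 (fun a => CS8.TT (CS8.HL cs) a ω * (CS8.TT (CS8.HL cs) a ω).transpose)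
    (fun _ => rfl) (fun i a => CS8.X_swap cs h0 hωr hωw a i)
    (fun a => CS8.X_pow cs h0 hk a true) (fun a => CS8.TT_trace cs a h0 γ hperm)
    (CS8.TT_sq_HD cs ω).1 (CS8.zz cs) hder l
  rw [CS8.TT_zero] at hmain
  have hcw : cs.wordProd (List.ofFn σ).reverse = c⁻¹ := by
    rw [cs.wordProd_reverse, hc, CoxeterSystem.wordProd, List.map_ofFn]; rfl
  have hσ : (List.ofFn σ).Perm (List.finRange n) := Equiv.Perm.ofFn_comp_perm σ id
  have hconj : IsConj c⁻¹ (cs.wordProd γ) := by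
    rw [← hcw]
    have hp : (List.ofFn σ).reverse.Perm γ :=
      (List.reverse_perm _).trans (hσ.trans hperm.symm)
    exact (CS8.CR_of_perm hleaf _ _ γ rfl
      (hp.nodup_iff.2 (hperm.nodup_iff.2 (List.nodup_finRange n))) hp).isConj cs
  rw [hN, ← CS8.trace_count, CS8.trace_conj cs hconj, hmain]
  have hlen : k * n = 2 * nR := by
    have h1 := CS8.card_refl cs h0 (hk true).1 (hk true).2
    have h2 := CS8.card_refl cs h0 (hk false).1 (hk false).2
    have h3 := CS8.altw_length col true k
    simp only [Bool.not_true] at h3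
    omega
  have hlen' : (k : ℝ) * n = 2 * nR := by exact_mod_cast hlen
  have hn0 : (n : ℝ) ≠ 0 := by positivity
  refine Finset.sum_congr rfl fun i _ => ?_
  congr 2
  field_simp
  linear_combination ((n : ℝ) - 2 * i) * hlen'
end
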